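/- arXiv:2110.15545 — 11 statements merged into one kernel-verified Lean document; each statement's English description precedes it below -/
import Mathlib

section
/- For every ε ∈ [0,1], the threshold classifier f_ε^CFL satisfies DPDisp(f_ε^CFL) = min(ε, |g(0)|) ≤ ε, and for every randomized classifier f : ℝ × {0,1} → [0,1] with DPDisp(f) ≤ ε one has err(f_ε^CFL) ≤ err(f). That is, f_ε^CFL solves the centralized fair learning problem CFL(ε) of minimizing classification error subject to demographic-parity disparity at most ε. -/
open MeasureTheory Set

noncomputable section

/-- A randomized classifier: measurable in `x` for each group, values in `[0,1]`. -/
def IsClf (f : ℝ → Fin 2 → ℝ) : Prop :=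
  (∀ a, Measurable fun x => f x a) ∧ ∀ x a, f x a ∈ Icc (0:ℝ) 1

/-- Classification error of a randomized classifier. -/
def errF (q : ℝ) (η : ℝ → ℝ) (P0 P1 : Measure ℝ) (f : ℝ → Fin 2 → ℝ) : ℝ :=
  (1 - q) * (∫ x, (f x 0 * (1 - η x) + (1 - f x 0) * η x) ∂P0)
    + q * ∫ x, (f x 1 * (1 - η x) + (1 - f x 1) * η x) ∂P1

/-- Mean difference between the two groups. -/
def MDF (P0 P1 : Measure ℝ) (f : ℝ → Fin 2 → ℝ) : ℝ :=
  (∫ x, f x 0 ∂P0) - ∫ x, f x 1 ∂P1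

/-- Demographic parity disparity. -/
def DPD (P0 P1 : Measure ℝ) (f : ℝ → Fin 2 → ℝ) : ℝ := |MDF P0 P1 f|

/-- The function `g`. -/
def gFun (q : ℝ) (η : ℝ → ℝ) (P0 P1 : Measure ℝ) (lam : ℝ) : ℝ :=
  (P0 {x | η x > 1/2 - lam / (2*(1-q))}).toReal
    - (P1 {x | η x > 1/2 + lam / (2*q)}).toReal

/-- The threshold classifier with parameter `λ`. -/
def fThresh (q : ℝ) (η : ℝ → ℝ) (lam : ℝ) : ℝ → Fin 2 → ℝ := fun x a =>
  if a = 0 then (if η x > 1/2 - lam / (2*(1-q)) then 1 else 0)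
  else (if η x > 1/2 + lam / (2*q) then 1 else 0)

/-- `g` is a continuous strictly increasing bijection from `[-M,M]` onto `[-1,1]`,
with inverse `ginv`. -/
def GoodG (M : ℝ) (g ginv : ℝ → ℝ) : Prop :=
  ContinuousOn g (Icc (-M) M) ∧ StrictMonoOn g (Icc (-M) M) ∧
    g '' Icc (-M) M = Icc (-1) 1 ∧
    (∀ lam ∈ Icc (-M) M, ginv (g lam) = lam) ∧
    (∀ y ∈ Icc (-1:ℝ) 1, ginv y ∈ Icc (-M) M ∧ g (ginv y) = y)

/-- Pointwise Lagrangian comparison integrated over one group. -/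
theorem group_lagrange (P : Measure ℝ) [IsProbabilityMeasure P] (η : ℝ → ℝ) (hm : Measurable η)
    (hη : ∀ x, η x ∈ Icc (0:ℝ) 1) (c mu t : ℝ) (hc : 0 < c) (ht : t = 1/2 - mu / (2*c))
    (u : ℝ → ℝ) (hu : Measurable u) (hu1 : ∀ x, u x ∈ Icc (0:ℝ) 1) :
    c * (∫ x, ((if η x > t then (1:ℝ) else 0) * (1 - η x)
      + (1 - (if η x > t then (1:ℝ) else 0)) * η x) ∂P)
      - mu * (∫ x, (if η x > t then (1:ℝ) else 0) ∂P)
    ≤ c * (∫ x, (u x * (1 - η x) + (1 - u x) * η x) ∂P) - mu * (∫ x, u x ∂P) := by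
  have hT : Measurable (fun x => if η x > t then (1:ℝ) else 0) :=
    Measurable.ite (measurableSet_lt measurable_const hm) measurable_const measurable_const
  have hT1 : ∀ x, (fun x => if η x > t then (1:ℝ) else 0) x ∈ Icc (0:ℝ) 1 := by
    intro x
    dsimp only
    split_ifs <;> simp
  have key : ∀ v : ℝ → ℝ, Measurable v → (∀ x, v x ∈ Icc (0:ℝ) 1) →
      Integrable v P ∧ Integrable (fun x => v x * (1 - η x) + (1 - v x) * η x) P := by
    intro v hv hv1
    constructor
    · refine Integrable.of_bound hv.aestronglyMeasurable 1 (Filter.Eventually.of_forall ?_)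
      intro x
      rw [Real.norm_eq_abs, abs_le]
      obtain ⟨h1, h2⟩ := hv1 x
      constructor <;> linarith
    · refine Integrable.of_bound (Measurable.aestronglyMeasurable (by fun_prop)) 1
        (Filter.Eventually.of_forall ?_)
      intro x
      rw [Real.norm_eq_abs, abs_le]
      obtain ⟨h1, h2⟩ := hv1 x
      obtain ⟨h3, h4⟩ := hη x
      constructor <;> nlinarith [mul_nonneg h1 h3, mul_nonneg (sub_nonneg.2 h2) (sub_nonneg.2 h4),
        mul_nonneg h1 (sub_nonneg.2 h4), mul_nonneg (sub_nonneg.2 h2) h3]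
  obtain ⟨a1, a2⟩ := key _ hT hT1
  obtain ⟨b1, b2⟩ := key u hu hu1
  rw [← integral_const_mul, ← integral_const_mul, ← integral_const_mul, ← integral_const_mul,
    ← integral_sub (a2.const_mul c) (a1.const_mul mu),
    ← integral_sub (b2.const_mul c) (b1.const_mul mu)]
  refine integral_mono ((a2.const_mul c).sub (a1.const_mul mu))
    ((b2.const_mul c).sub (b1.const_mul mu)) ?_
  intro x
  obtain ⟨h1, h2⟩ := hu1 x
  have hct : 2 * c * t = c - mu := by
    rw [ht]; field_simp
  dsimp only
  split_ifs with h
  · have : c * t < c * η x := mul_lt_mul_of_pos_left h hc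
    nlinarith [mul_nonneg (sub_nonneg.2 h2) (sub_nonneg.2 this.le)]
  · have : c * η x ≤ c * t := mul_le_mul_of_nonneg_left (not_lt.1 h) hc.le
    nlinarith [mul_nonneg h1 (sub_nonneg.2 this)]

theorem integral_thresh (P : Measure ℝ) [IsProbabilityMeasure P] (η : ℝ → ℝ) (hm : Measurable η)
    (t : ℝ) : (∫ x, (if η x > t then (1:ℝ) else 0) ∂P) = (P {x | η x > t}).toReal := by
  have hs : MeasurableSet {x | η x > t} := measurableSet_lt measurable_const hm
  have := integral_indicator_one (μ := P) hs
  rw [Measure.real] at this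
  rw [← this]
  congr 1

/-- the threshold classifier `f_ε^CFL` has DP disparity exactly
`min ε |g 0|` (hence at most `ε`) and minimizes the classification error among
all randomized classifiers with DP disparity at most `ε`. -/
theorem cfl_threshold_optimal
    (q : ℝ) (hq : q ∈ Ioo (0:ℝ) 1)
    (P0 P1 : Measure ℝ) [IsProbabilityMeasure P0] [IsProbabilityMeasure P1]
    (η : ℝ → ℝ) (hη_mono : StrictMono η) (hη_mem : ∀ x, η x ∈ Icc (0:ℝ) 1)
    (ginv : ℝ → ℝ)
    (hg : GoodG (max q (1 - q)) (gFun q η P0 P1) ginv)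
    (ε : ℝ) (hε : ε ∈ Icc (0:ℝ) 1)
    (lamε : ℝ)
    (hlam : lamε = ginv (Real.sign (gFun q η P0 P1 0) * min ε |gFun q η P0 P1 0|)) :
    DPD P0 P1 (fThresh q η lamε) = min ε |gFun q η P0 P1 0| ∧
    DPD P0 P1 (fThresh q η lamε) ≤ ε ∧
    ∀ f : ℝ → Fin 2 → ℝ, IsClf f → DPD P0 P1 f ≤ ε →
      errF q η P0 P1 (fThresh q η lamε) ≤ errF q η P0 P1 f := by
  obtain ⟨hq0, hq1⟩ := hq
  have hm : Measurable η := hη_mono.monotone.measurable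
  have hMD : ∀ l, MDF P0 P1 (fThresh q η l) = gFun q η P0 P1 l := by
    intro l
    simp only [MDF, fThresh, gFun, if_true, one_ne_zero, if_false]
    rw [integral_thresh P0 η hm, integral_thresh P1 η hm]
  obtain ⟨-, hmono, him, hleft, hright⟩ := hg
  set g := gFun q η P0 P1 with hgdef
  have hM0 : (0:ℝ) ∈ Icc (-(max q (1-q))) (max q (1-q)) := by
    have : q ≤ max q (1-q) := le_max_left _ _
    constructor <;> linarith
  have hmin0 : 0 ≤ min ε |g 0| := le_min hε.1 (abs_nonneg _)
  have hmin1 : min ε |g 0| ≤ 1 := (min_le_left _ _).trans hε.2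
  have hy : Real.sign (g 0) * min ε |g 0| ∈ Icc (-1:ℝ) 1 := by
    rcases Real.sign_apply_eq (g 0) with h | h | h <;> rw [h] <;> constructor <;> linarith
  obtain ⟨hl, hgl⟩ := hright _ hy
  rw [← hlam] at hl hgl
  have hD : DPD P0 P1 (fThresh q η lamε) = min ε |g 0| := by
    rw [DPD, hMD, hgl, abs_mul, abs_of_nonneg hmin0]
    rcases lt_trichotomy (g 0) 0 with h | h | h
    · simp [Real.sign_of_neg h]
    · simp [h, hε.1]
    · simp [Real.sign_of_pos h]
  refine ⟨hD, hD.le.trans (min_le_left _ _), ?_⟩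
  intro f hf hfε
  have hfε' := abs_le.1 hfε
  have hL0 := group_lagrange P0 η hm hη_mem (1-q) lamε (1/2 - lamε / (2*(1-q))) (by linarith) rfl
    (fun x => f x 0) (hf.1 0) (fun x => hf.2 x 0)
  have hL1 := group_lagrange P1 η hm hη_mem q (-lamε) (1/2 + lamε / (2*q)) hq0 (by ring)
    (fun x => f x 1) (hf.1 1) (fun x => hf.2 x 1)
  have hLag : errF q η P0 P1 (fThresh q η lamε) - lamε * MDF P0 P1 (fThresh q η lamε)
      ≤ errF q η P0 P1 f - lamε * MDF P0 P1 f := by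
    simp only [errF, MDF, fThresh, if_true, one_ne_zero, if_false]
    linarith
  have hslack : lamε * (g lamε - MDF P0 P1 f) ≤ 0 := by
    by_cases hc : |g 0| ≤ ε
    · have : g lamε = g 0 := by
        rw [hgl, min_eq_right hc]
        rcases lt_trichotomy (g 0) 0 with h | h | h
        · rw [Real.sign_of_neg h, abs_of_neg h]; ring
        · simp [h]
        · rw [Real.sign_of_pos h, abs_of_pos h]; ring
      have h0 := hmono.injOn hl hM0 this
      simp [h0]
    · push Not at hc
      rw [min_eq_left hc.le] at hgl
      rcases lt_trichotomy (g 0) 0 with h | h | h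
      · rw [Real.sign_of_neg h] at hgl
        rw [abs_of_neg h] at hc
        have : 0 < lamε := (hmono.lt_iff_lt hM0 hl).1 (by linarith)
        exact mul_nonpos_of_nonneg_of_nonpos this.le (by linarith)
      · rw [h, abs_zero] at hc
        linarith [hε.1]
      · rw [Real.sign_of_pos h] at hgl
        rw [abs_of_pos h] at hc
        have : lamε < 0 := (hmono.lt_iff_lt hl hM0).1 (by linarith)
        exact mul_nonpos_of_nonpos_of_nonneg this.le (by linarith)
  rw [hMD] at hLag
  linarith

end
end

section
/- For every λ ∈ ℝ, the threshold classifier f_λ defined by f_λ(x,0) = 1{η(x) > 1/2 − λ/(2(1−q))} and f_λ(x,1) = 1{η(x) > 1/2 + λ/(2q)} minimizes the Lagrangian objective err(f) − λ·MD(f) over all randomized classifiers f : ℝ × {0,1} → [0,1]. -/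
open MeasureTheory Set

noncomputable section

/-- One-group version of the claim. -/
lemma one_group_threshold (w l t : ℝ) (hw : 0 < w) (ht : w * (1 - 2 * t) = l)
    (P : Measure ℝ) [IsProbabilityMeasure P]
    (η : ℝ → ℝ) (hη : Measurable η) (hη_mem : ∀ x, η x ∈ Icc (0:ℝ) 1)
    (F f : ℝ → ℝ) (hF : ∀ x, F x = if η x > t then 1 else 0)
    (hf : Measurable f) (hf_mem : ∀ x, f x ∈ Icc (0:ℝ) 1) :
    w * (∫ x, (F x * (1 - η x) + (1 - F x) * η x) ∂P) - l * ∫ x, F x ∂P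
      ≤ w * (∫ x, (f x * (1 - η x) + (1 - f x) * η x) ∂P) - l * ∫ x, f x ∂P := by
  have hFm : Measurable F := by
    have : F = fun x => if η x > t then (1:ℝ) else 0 := funext hF
    rw [this]
    exact Measurable.ite (measurableSet_lt measurable_const hη) measurable_const measurable_const
  have hF_mem : ∀ x, F x ∈ Icc (0:ℝ) 1 := by
    intro x
    rw [hF x]
    split_ifs <;> simp
  have int1 : ∀ g : ℝ → ℝ, Measurable g → (∀ x, g x ∈ Icc (0:ℝ) 1) → Integrable g P := by
    intro g hg hm
    refine Integrable.of_bound hg.aestronglyMeasurable 1 (Filter.Eventually.of_forall fun x => ?_)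
    rw [Real.norm_eq_abs, abs_le]
    constructor <;> linarith [(hm x).1, (hm x).2]
  have int2 : ∀ g : ℝ → ℝ, Measurable g → (∀ x, g x ∈ Icc (0:ℝ) 1) →
      Integrable (fun x => g x * (1 - η x) + (1 - g x) * η x) P := by
    intro g hg hm
    refine int1 _ (by fun_prop) fun x => ?_
    obtain ⟨a, b⟩ := hm x
    obtain ⟨c, d⟩ := hη_mem x
    constructor <;> nlinarith [mul_nonneg a c, mul_nonneg (sub_nonneg.2 b) (sub_nonneg.2 d),
      mul_nonneg a (sub_nonneg.2 d), mul_nonneg (sub_nonneg.2 b) c]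
  have key : ∀ g : ℝ → ℝ, Measurable g → (∀ x, g x ∈ Icc (0:ℝ) 1) →
      w * (∫ x, (g x * (1 - η x) + (1 - g x) * η x) ∂P) - l * ∫ x, g x ∂P
        = ∫ x, (w * (g x * (1 - η x) + (1 - g x) * η x) - l * g x) ∂P := by
    intro g hg hm
    rw [integral_sub ((int2 g hg hm).const_mul w) ((int1 g hg hm).const_mul l),
      integral_const_mul, integral_const_mul]
  rw [key F hFm hF_mem, key f hf hf_mem]
  refine integral_mono (((int2 F hFm hF_mem).const_mul w).sub ((int1 F hFm hF_mem).const_mul l))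
    (((int2 f hf hf_mem).const_mul w).sub ((int1 f hf hf_mem).const_mul l)) fun x => ?_
  obtain ⟨a, b⟩ := hf_mem x
  simp only [hF x, ← ht]
  split_ifs with h
  · nlinarith [mul_nonneg hw.le (mul_nonneg (sub_nonneg.2 b) (sub_nonneg.2 h.le))]
  · nlinarith [mul_nonneg hw.le (mul_nonneg a (sub_nonneg.2 (not_lt.1 h)))]

/-- for every `λ`, the threshold classifier minimizes the Lagrangian
objective `err f - λ · MD f` over all randomized classifiers. -/
theorem threshold_minimizes_lagrangian
    (q : ℝ) (hq : q ∈ Ioo (0:ℝ) 1)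
    (P0 P1 : Measure ℝ) [IsProbabilityMeasure P0] [IsProbabilityMeasure P1]
    (η : ℝ → ℝ) (hη_mono : StrictMono η) (hη_mem : ∀ x, η x ∈ Icc (0:ℝ) 1)
    (lam : ℝ) :
    ∀ f : ℝ → Fin 2 → ℝ, IsClf f →
      errF q η P0 P1 (fThresh q η lam) - lam * MDF P0 P1 (fThresh q η lam)
        ≤ errF q η P0 P1 f - lam * MDF P0 P1 f := by
  intro f hf
  obtain ⟨hq0, hq1⟩ := hq
  have hq1' : 0 < 1 - q := by linarith
  have h0 := one_group_threshold (1 - q) lam (1/2 - lam / (2*(1-q))) hq1' (by field_simp; ring)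
    P0 η hη_mono.monotone.measurable hη_mem (fun x => fThresh q η lam x 0) (fun x => f x 0)
    (fun x => by simp [fThresh]) (hf.1 0) (fun x => hf.2 x 0)
  have h1 := one_group_threshold q (-lam) (1/2 + lam / (2*q)) hq0 (by field_simp; ring)
    P1 η hη_mono.monotone.measurable hη_mem (fun x => fThresh q η lam x 1) (fun x => f x 1)
    (fun x => by simp [fThresh]) (hf.1 1) (fun x => hf.2 x 1)
  unfold errF MDF
  linarith

end
end

section
/- Suppose in addition that 𝒫₀({x : η(x) = 1/2}) = 𝒫₁({x : η(x) = 1/2}) = 0. Let ε ∈ [0,1] and let f* be a randomized classifier with DPDisp(f*) ≤ ε such that err(f*) ≤ err(f) for every randomized classifier f with DPDisp(f) ≤ ε. If g(0) > ε, then MD(f*) = ε; symmetrically, if g(0) < −ε, then MD(f*) = −ε. (Here g(0) = MD(f̃) where f̃(x,a) = 1{η(x) > 1/2} is the unconstrained error minimizer.) -/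
open MeasureTheory Set

noncomputable section

/-- Per-group error of a randomized rule. -/
def lossF (η : ℝ → ℝ) (P : Measure ℝ) (u : ℝ → ℝ) : ℝ :=
  ∫ x, (u x * (1 - η x) + (1 - u x) * η x) ∂P

/-- The unconstrained minimizer. -/
def bayesF (η : ℝ → ℝ) : ℝ → ℝ := fun x => if η x > 1/2 then 1 else 0

theorem bayes_meas (η : ℝ → ℝ) (h : Measurable η) : Measurable (bayesF η) :=
  Measurable.ite (measurableSet_lt measurable_const h) measurable_const measurable_const

theorem bayes_mem (η : ℝ → ℝ) (x : ℝ) : bayesF η x ∈ Icc (0:ℝ) 1 := by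
  unfold bayesF
  split_ifs <;> simp

theorem integrable_unit (P : Measure ℝ) [IsProbabilityMeasure P] (u : ℝ → ℝ)
    (hu : Measurable u) (hm : ∀ x, u x ∈ Icc (0:ℝ) 1) : Integrable u P :=
  Integrable.of_mem_Icc 0 1 hu.aemeasurable (Filter.Eventually.of_forall hm)

theorem loss_mem (a b : ℝ) (ha : a ∈ Icc (0:ℝ) 1) (hb : b ∈ Icc (0:ℝ) 1) :
    a * (1 - b) + (1 - a) * b ∈ Icc (0:ℝ) 1 := by
  obtain ⟨h1, h2⟩ := ha
  obtain ⟨h3, h4⟩ := hb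
  constructor <;> nlinarith [mul_nonneg h1 h3, mul_nonneg h1 (sub_nonneg.2 h4),
    mul_nonneg (sub_nonneg.2 h2) h3, mul_nonneg (sub_nonneg.2 h2) (sub_nonneg.2 h4)]

theorem loss_integrable (P : Measure ℝ) [IsProbabilityMeasure P] (η u : ℝ → ℝ)
    (hη : Measurable η) (hηm : ∀ x, η x ∈ Icc (0:ℝ) 1)
    (hu : Measurable u) (hm : ∀ x, u x ∈ Icc (0:ℝ) 1) :
    Integrable (fun x => u x * (1 - η x) + (1 - u x) * η x) P :=
  integrable_unit P _ (by fun_prop) fun x => loss_mem _ _ (hm x) (hηm x)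

theorem loss_pt (η : ℝ → ℝ) (x a : ℝ) (ha : a ∈ Icc (0:ℝ) 1) :
    bayesF η x * (1 - η x) + (1 - bayesF η x) * η x ≤ a * (1 - η x) + (1 - a) * η x := by
  obtain ⟨h1, h2⟩ := ha
  unfold bayesF
  split_ifs with h <;> nlinarith

theorem loss_le (P : Measure ℝ) [IsProbabilityMeasure P] (η u : ℝ → ℝ)
    (hη : Measurable η) (hηm : ∀ x, η x ∈ Icc (0:ℝ) 1)
    (hu : Measurable u) (hm : ∀ x, u x ∈ Icc (0:ℝ) 1) :
    lossF η P (bayesF η) ≤ lossF η P u :=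
  integral_mono (loss_integrable P η _ hη hηm (bayes_meas η hη) (bayes_mem η))
    (loss_integrable P η u hη hηm hu hm) fun x => loss_pt η x _ (hm x)

theorem loss_unique (P : Measure ℝ) [IsProbabilityMeasure P] (η u : ℝ → ℝ)
    (hη : Measurable η) (hηm : ∀ x, η x ∈ Icc (0:ℝ) 1) (hnull : P {x | η x = 1/2} = 0)
    (hu : Measurable u) (hm : ∀ x, u x ∈ Icc (0:ℝ) 1)
    (h : lossF η P u ≤ lossF η P (bayesF η)) : ∫ x, u x ∂P = ∫ x, bayesF η x ∂P := by
  have hb := loss_integrable P η _ hη hηm (bayes_meas η hη) (bayes_mem η)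
  have hi := loss_integrable P η u hη hηm hu hm
  have heq := (integral_eq_iff_of_ae_le hb hi
    (Filter.Eventually.of_forall fun x => loss_pt η x _ (hm x))).1
      (le_antisymm (loss_le P η u hη hηm hu hm) h)
  have hn : ∀ᵐ x ∂P, η x ≠ 1/2 := by
    rw [ae_iff]
    simpa using hnull
  apply integral_congr_ae
  filter_upwards [heq, hn] with x h1 h2
  have h3 : (u x - bayesF η x) * (η x - 1/2) = 0 := by
    linarith
  rcases mul_eq_zero.1 h3 with h4 | h4
  · linarith
  · exact absurd (by linarith) h2

theorem loss_mix (P : Measure ℝ) [IsProbabilityMeasure P] (η u v : ℝ → ℝ)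
    (hη : Measurable η) (hηm : ∀ x, η x ∈ Icc (0:ℝ) 1)
    (hu : Measurable u) (hm : ∀ x, u x ∈ Icc (0:ℝ) 1)
    (hv : Measurable v) (hvm : ∀ x, v x ∈ Icc (0:ℝ) 1) (t : ℝ) :
    lossF η P (fun x => (1 - t) * u x + t * v x)
      = (1 - t) * lossF η P u + t * lossF η P v := by
  unfold lossF
  rw [← integral_const_mul, ← integral_const_mul, ← integral_add
    ((loss_integrable P η u hη hηm hu hm).const_mul _)
    ((loss_integrable P η v hη hηm hv hvm).const_mul _)]
  congr 1
  ext x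
  ring

theorem int_mix (P : Measure ℝ) [IsProbabilityMeasure P] (u v : ℝ → ℝ)
    (hu : Measurable u) (hm : ∀ x, u x ∈ Icc (0:ℝ) 1)
    (hv : Measurable v) (hvm : ∀ x, v x ∈ Icc (0:ℝ) 1) (t : ℝ) :
    ∫ x, ((1 - t) * u x + t * v x) ∂P = (1 - t) * ∫ x, u x ∂P + t * ∫ x, v x ∂P := by
  rw [← integral_const_mul, ← integral_const_mul, ← integral_add
    ((integrable_unit P u hu hm).const_mul _) ((integrable_unit P v hv hvm).const_mul _)]

theorem int_bayes (P : Measure ℝ) (η : ℝ → ℝ) (hη : Measurable η) :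
    ∫ x, bayesF η x ∂P = (P {x | η x > 1/2}).toReal := by
  have hs : MeasurableSet {x | η x > 1/2} := measurableSet_lt measurable_const hη
  have := integral_indicator_one (μ := P) hs
  rw [Measure.real] at this
  rw [← this]
  congr 1

/-- Moving towards the unconstrained minimizer: a feasible proper mixture forces the
mean difference of the optimal classifier to be `g 0`. -/
theorem key_mix
    (q : ℝ) (hq : q ∈ Ioo (0:ℝ) 1)
    (P0 P1 : Measure ℝ) [IsProbabilityMeasure P0] [IsProbabilityMeasure P1]
    (η : ℝ → ℝ) (hη : Measurable η) (hηm : ∀ x, η x ∈ Icc (0:ℝ) 1)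
    (hnull0 : P0 {x | η x = 1/2} = 0) (hnull1 : P1 {x | η x = 1/2} = 0)
    (ε : ℝ) (fstar : ℝ → Fin 2 → ℝ) (hfs : IsClf fstar)
    (hopt : ∀ f : ℝ → Fin 2 → ℝ, IsClf f → DPD P0 P1 f ≤ ε →
      errF q η P0 P1 fstar ≤ errF q η P0 P1 f)
    (t : ℝ) (ht0 : 0 < t) (ht1 : t ≤ 1)
    (hd : |(1 - t) * MDF P0 P1 fstar + t * gFun q η P0 P1 0| ≤ ε) :
    MDF P0 P1 fstar = gFun q η P0 P1 0 := by
  obtain ⟨hq0, hq1⟩ := hq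
  obtain ⟨hfm, hfI⟩ := hfs
  have hbm := bayes_meas η hη
  have hbI := bayes_mem η
  have hG : gFun q η P0 P1 0 = ∫ x, bayesF η x ∂P0 - ∫ x, bayesF η x ∂P1 := by
    rw [int_bayes P0 η hη, int_bayes P1 η hη]
    simp [gFun]
  have hc : IsClf (fun x a => (1 - t) * fstar x a + t * bayesF η x) := by
    refine ⟨fun a => ((hfm a).const_mul _).add (hbm.const_mul _), fun x a => ?_⟩
    obtain ⟨h1, h2⟩ := hfI x a
    obtain ⟨h3, h4⟩ := hbI x
    constructor <;> dsimp only <;> nlinarith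
  have hM : MDF P0 P1 (fun x a => (1 - t) * fstar x a + t * bayesF η x)
      = (1 - t) * MDF P0 P1 fstar + t * gFun q η P0 P1 0 := by
    rw [hG]
    unfold MDF
    rw [int_mix P0 _ _ (hfm 0) (fun x => hfI x 0) hbm hbI,
      int_mix P1 _ _ (hfm 1) (fun x => hfI x 1) hbm hbI]
    ring
  have ho := hopt _ hc (by unfold DPD; rw [hM]; exact hd)
  change (1 - q) * lossF η P0 (fun x => fstar x 0) + q * lossF η P1 (fun x => fstar x 1)
    ≤ (1 - q) * lossF η P0 (fun x => (1 - t) * fstar x 0 + t * bayesF η x)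
      + q * lossF η P1 (fun x => (1 - t) * fstar x 1 + t * bayesF η x) at ho
  rw [loss_mix P0 η _ _ hη hηm (hfm 0) (fun x => hfI x 0) hbm hbI,
      loss_mix P1 η _ _ hη hηm (hfm 1) (fun x => hfI x 1) hbm hbI] at ho
  have l0 := loss_le P0 η _ hη hηm (hfm 0) (fun x => hfI x 0)
  have l1 := loss_le P1 η _ hη hηm (hfm 1) (fun x => hfI x 1)
  have hsum : (1 - q) * (lossF η P0 (fun x => fstar x 0) - lossF η P0 (bayesF η))
      + q * (lossF η P1 (fun x => fstar x 1) - lossF η P1 (bayesF η)) ≤ 0 := by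
    refine le_of_mul_le_mul_left ?_ ht0
    linarith
  have k0 := mul_nonneg (sub_nonneg.2 hq1.le) (sub_nonneg.2 l0)
  have k1 := mul_nonneg hq0.le (sub_nonneg.2 l1)
  have e0 : lossF η P0 (fun x => fstar x 0) ≤ lossF η P0 (bayesF η) :=
    sub_nonpos.1 (le_of_mul_le_mul_left (by linarith) (sub_pos.2 hq1))
  have e1 : lossF η P1 (fun x => fstar x 1) ≤ lossF η P1 (bayesF η) :=
    sub_nonpos.1 (le_of_mul_le_mul_left (by linarith) hq0)
  rw [hG, ← loss_unique P0 η _ hη hηm hnull0 (hfm 0) (fun x => hfI x 0) e0,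
    ← loss_unique P1 η _ hη hηm hnull1 (hfm 1) (fun x => hfI x 1) e1]
  rfl

/-- any optimal classifier for CFL(ε) meets the fairness constraint
with equality when the unconstrained minimizer is too unfair. -/
theorem optimal_meets_constraint
    (q : ℝ) (hq : q ∈ Ioo (0:ℝ) 1)
    (P0 P1 : Measure ℝ) [IsProbabilityMeasure P0] [IsProbabilityMeasure P1]
    (η : ℝ → ℝ) (hη_mono : StrictMono η) (hη_mem : ∀ x, η x ∈ Icc (0:ℝ) 1)
    (hnull0 : P0 {x | η x = 1/2} = 0) (hnull1 : P1 {x | η x = 1/2} = 0)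
    (ginv : ℝ → ℝ)
    (hg : GoodG (max q (1 - q)) (gFun q η P0 P1) ginv)
    (ε : ℝ) (hε : ε ∈ Icc (0:ℝ) 1)
    (fstar : ℝ → Fin 2 → ℝ) (hfs : IsClf fstar)
    (hfair : DPD P0 P1 fstar ≤ ε)
    (hopt : ∀ f : ℝ → Fin 2 → ℝ, IsClf f → DPD P0 P1 f ≤ ε →
      errF q η P0 P1 fstar ≤ errF q η P0 P1 f) :
    (gFun q η P0 P1 0 > ε → MDF P0 P1 fstar = ε) ∧
    (gFun q η P0 P1 0 < -ε → MDF P0 P1 fstar = -ε) := by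
  have key := key_mix q hq P0 P1 η hη_mono.monotone.measurable hη_mem hnull0 hnull1 ε fstar hfs
    hopt
  obtain ⟨hm1, hm2⟩ := abs_le.1 hfair
  obtain ⟨hε0, -⟩ := hε
  set m := MDF P0 P1 fstar with hm
  set G := gFun q η P0 P1 0 with hGd
  constructor
  · intro hG
    by_contra hne
    have hlt : m < ε := lt_of_le_of_ne hm2 hne
    have hpos : 0 < G - m := by linarith
    have := key ((ε - m) / (G - m)) (div_pos (by linarith) hpos)
      ((div_le_one hpos).2 (by linarith)) (by
        have : (1 - (ε - m) / (G - m)) * m + (ε - m) / (G - m) * G = ε := by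
          field_simp
          ring
        rw [this, abs_of_nonneg hε0])
    linarith
  · intro hG
    by_contra hne
    have hlt : -ε < m := lt_of_le_of_ne hm1 (Ne.symm hne)
    have hpos : 0 < m - G := by linarith
    have := key ((m + ε) / (m - G)) (div_pos (by linarith) hpos)
      ((div_le_one hpos).2 (by linarith)) (by
        have : (1 - (m + ε) / (m - G)) * m + (m + ε) / (m - G) * G = -ε := by
          field_simp
          ring
        rw [this, abs_neg, abs_of_nonneg hε0])
    linarith

end
end

section
/- Suppose in addition that 𝒫₀({x : η(x) = c}) = 𝒫₁({x : η(x) = c}) = 0 for every c ∈ ℝ. Fix ε ∈ [0,1], and suppose f and f' are both optimal for CFL(ε), i.e., each satisfies DPDisp ≤ ε and minimizes err among all randomized classifiers with DPDisp ≤ ε. Then f(x,0) = f'(x,0) for 𝒫₀-almost every x and f(x,1) = f'(x,1) for 𝒫₁-almost every x. -/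
open MeasureTheory Set

noncomputable section

theorem clf_aux_group (P : Measure ℝ) [IsProbabilityMeasure P] (h t w : ℝ → ℝ)
    (hnn : ∀ x, 0 ≤ (h x - t x) * w x) (hw : ∀ᵐ x ∂P, w x ≠ 0)
    (hint : Integrable (fun x => (h x - t x) * w x) P)
    (hz : ∫ x, (h x - t x) * w x ∂P ≤ 0) : ∀ᵐ x ∂P, h x = t x := by
  have h0 : ∫ x, (h x - t x) * w x ∂P = 0 := le_antisymm hz (integral_nonneg hnn)
  have h1 := (integral_eq_zero_iff_of_nonneg hnn hint).1 h0
  filter_upwards [h1, hw] with x hx hwx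
  have : (h x - t x) * w x = 0 := hx
  rcases mul_eq_zero.1 this with h2 | h2
  · linarith
  · exact absurd h2 hwx

theorem clf_aux_int (P : Measure ℝ) [IsProbabilityMeasure P] (h : ℝ → ℝ)
    (hm : Measurable h) (C : ℝ) (hb : ∀ x, |h x| ≤ C) : Integrable h P :=
  Integrable.of_bound hm.aestronglyMeasurable C (Filter.Eventually.of_forall hb)

/-- the difference of weighted integrals -/
theorem clf_aux_diff (P : Measure ℝ) [IsProbabilityMeasure P] (η h t : ℝ → ℝ) (a l : ℝ)
    (hη : Measurable η) (hη_mem : ∀ x, η x ∈ Icc (0:ℝ) 1)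
    (hh : Measurable h) (hh' : ∀ x, h x ∈ Icc (0:ℝ) 1)
    (ht : Measurable t) (ht' : ∀ x, t x ∈ Icc (0:ℝ) 1) :
    Integrable (fun x => (h x - t x) * (a * (1 - 2 * η x) - l)) P ∧
    ∫ x, (h x - t x) * (a * (1 - 2 * η x) - l) ∂P =
      a * (∫ x, (h x * (1 - η x) + (1 - h x) * η x) ∂P)
      - a * (∫ x, (t x * (1 - η x) + (1 - t x) * η x) ∂P)
      - l * (∫ x, h x ∂P) + l * ∫ x, t x ∂P := by
  have ih : Integrable h P := clf_aux_int P h hh 1 fun x => by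
    have := hh' x; rw [abs_le]; constructor <;> linarith [this.1, this.2]
  have it : Integrable t P := clf_aux_int P t ht 1 fun x => by
    have := ht' x; rw [abs_le]; constructor <;> linarith [this.1, this.2]
  have key : ∀ k : ℝ → ℝ, Measurable k → (∀ x, k x ∈ Icc (0:ℝ) 1) →
      Integrable (fun x => k x * (1 - η x) + (1 - k x) * η x) P := by
    intro k hk hk'
    refine clf_aux_int P _ (by fun_prop) 1 fun x => ?_
    have h1 := hk' x
    have h2 := hη_mem x
    obtain ⟨h1, h3⟩ := h1
    obtain ⟨h2, h4⟩ := h2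
    rw [abs_le]
    constructor <;> nlinarith [mul_nonneg h1 h2, mul_nonneg h1 (sub_nonneg.2 h4),
      mul_nonneg (sub_nonneg.2 h3) h2, mul_nonneg (sub_nonneg.2 h3) (sub_nonneg.2 h4)]
  have i1 := key h hh hh'
  have i2 := key t ht ht'
  have e : (fun x => (h x - t x) * (a * (1 - 2 * η x) - l)) = fun x =>
      a * (h x * (1 - η x) + (1 - h x) * η x) - a * (t x * (1 - η x) + (1 - t x) * η x)
      - l * h x + l * t x := by
    funext x; ring
  have j1 := i1.const_mul a
  have j2 := i2.const_mul a
  have j3 := ih.const_mul l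
  have j4 := it.const_mul l
  rw [e]
  refine ⟨((j1.sub j2).sub j3).add j4, ?_⟩
  rw [integral_add (by exact (j1.sub j2).sub j3) j4, integral_sub (by exact j1.sub j2) j3,
    integral_sub j1 j2]
  simp only [integral_const_mul]

theorem clf_aux_main
    (q : ℝ) (hq : q ∈ Ioo (0:ℝ) 1)
    (P0 P1 : Measure ℝ) [IsProbabilityMeasure P0] [IsProbabilityMeasure P1]
    (η : ℝ → ℝ) (hη : Measurable η) (hη_mem : ∀ x, η x ∈ Icc (0:ℝ) 1)
    (hnull : ∀ c : ℝ, P0 {x | η x = c} = 0 ∧ P1 {x | η x = c} = 0)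
    (lam : ℝ) (f : ℝ → Fin 2 → ℝ) (hf : IsClf f) (ht : IsClf (fThresh q η lam))
    (herr : errF q η P0 P1 f ≤ errF q η P0 P1 (fThresh q η lam))
    (hmd : lam * (MDF P0 P1 (fThresh q η lam) - MDF P0 P1 f) ≤ 0) :
    (∀ᵐ x ∂P0, f x 0 = fThresh q η lam x 0) ∧ ∀ᵐ x ∂P1, f x 1 = fThresh q η lam x 1 := by
  obtain ⟨hq0, hq1⟩ := hq
  have hq2 : 0 < 1 - q := by linarith
  obtain ⟨I0, E0⟩ := clf_aux_diff P0 η (fun x => f x 0) (fun x => fThresh q η lam x 0) (1 - q) lam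
    hη hη_mem (hf.1 0) (fun x => hf.2 x 0) (ht.1 0) (fun x => ht.2 x 0)
  obtain ⟨I1, E1⟩ := clf_aux_diff P1 η (fun x => f x 1) (fun x => fThresh q η lam x 1) q (-lam)
    hη hη_mem (hf.1 1) (fun x => hf.2 x 1) (ht.1 1) (fun x => ht.2 x 1)
  have c0 : (1 - q) * (lam / (2 * (1 - q))) = lam / 2 := by field_simp
  have c1 : q * (lam / (2 * q)) = lam / 2 := by field_simp
  have n0 : ∀ x, 0 ≤ (f x 0 - fThresh q η lam x 0) * ((1 - q) * (1 - 2 * η x) - lam) := by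
    intro x
    have hx := hf.2 x 0
    simp only [fThresh, if_true]
    split_ifs with hc
    · have := mul_lt_mul_of_pos_left hc hq2
      apply mul_nonneg_of_nonpos_of_nonpos
      · linarith [hx.2]
      · nlinarith
    · have := mul_le_mul_of_nonneg_left (not_lt.1 hc) hq2.le
      apply mul_nonneg
      · linarith [hx.1]
      · nlinarith
  have n1 : ∀ x, 0 ≤ (f x 1 - fThresh q η lam x 1) * (q * (1 - 2 * η x) - -lam) := by
    intro x
    have hx := hf.2 x 1
    simp only [fThresh, one_ne_zero, if_false]
    split_ifs with hc
    · have := mul_lt_mul_of_pos_left hc hq0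
      apply mul_nonneg_of_nonpos_of_nonpos
      · linarith [hx.2]
      · nlinarith
    · have := mul_le_mul_of_nonneg_left (not_lt.1 hc) hq0.le
      apply mul_nonneg
      · linarith [hx.1]
      · nlinarith
  have w0 : ∀ᵐ x ∂P0, (1 - q) * (1 - 2 * η x) - lam ≠ 0 := by
    refine measure_mono_null ?_ (hnull (1/2 - lam / (2*(1-q)))).1
    intro x hx
    have hx : (1 - q) * (1 - 2 * η x) - lam = 0 := not_not.1 hx
    show η x = _
    apply mul_left_cancel₀ hq2.ne'
    linarith
  have w1 : ∀ᵐ x ∂P1, q * (1 - 2 * η x) - -lam ≠ 0 := by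
    refine measure_mono_null ?_ (hnull (1/2 + lam / (2*q))).2
    intro x hx
    have hx : q * (1 - 2 * η x) - -lam = 0 := not_not.1 hx
    show η x = _
    apply mul_left_cancel₀ hq0.ne'
    linarith
  have p0 : 0 ≤ ∫ x, (f x 0 - fThresh q η lam x 0) * ((1 - q) * (1 - 2 * η x) - lam) ∂P0 :=
    integral_nonneg n0
  have p1 : 0 ≤ ∫ x, (f x 1 - fThresh q η lam x 1) * (q * (1 - 2 * η x) - -lam) ∂P1 :=
    integral_nonneg n1
  have hs : (∫ x, (f x 0 - fThresh q η lam x 0) * ((1 - q) * (1 - 2 * η x) - lam) ∂P0)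
      + ∫ x, (f x 1 - fThresh q η lam x 1) * (q * (1 - 2 * η x) - -lam) ∂P1 ≤ 0 := by
    rw [E0, E1]
    unfold errF at herr
    unfold MDF at hmd
    linarith
  exact ⟨clf_aux_group P0 _ _ _ n0 w0 I0 (by linarith),
    clf_aux_group P1 _ _ _ n1 w1 I1 (by linarith)⟩

theorem clf_aux_thresh (q : ℝ) (η : ℝ → ℝ) (hη : Measurable η) (lam : ℝ)
    (P0 P1 : Measure ℝ) [IsProbabilityMeasure P0] [IsProbabilityMeasure P1] :
    IsClf (fThresh q η lam) ∧ MDF P0 P1 (fThresh q η lam) = gFun q η P0 P1 lam := by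
  have m : ∀ c : ℝ, MeasurableSet {x | η x > c} := fun c => measurableSet_lt measurable_const hη
  refine ⟨⟨?_, ?_⟩, ?_⟩
  · intro a
    unfold fThresh
    split_ifs
    · exact Measurable.ite (m _) measurable_const measurable_const
    · exact Measurable.ite (m _) measurable_const measurable_const
  · intro x a
    unfold fThresh
    split_ifs <;> simp
  · have k : ∀ (P : Measure ℝ) (c : ℝ), ∫ x, (if η x > c then (1:ℝ) else 0) ∂P
        = (P {x | η x > c}).toReal := by
      intro P c
      have := integral_indicator_one (μ := P) (m c)
      rw [← Measure.real, ← this]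
      congr 1
    unfold MDF gFun
    rw [← k, ← k]
    simp [fThresh]

/-- any two optimal classifiers for CFL(ε) agree almost everywhere. -/
theorem cfl_solution_unique_ae
    (q : ℝ) (hq : q ∈ Ioo (0:ℝ) 1)
    (P0 P1 : Measure ℝ) [IsProbabilityMeasure P0] [IsProbabilityMeasure P1]
    (η : ℝ → ℝ) (hη_mono : StrictMono η) (hη_mem : ∀ x, η x ∈ Icc (0:ℝ) 1)
    (hnull : ∀ c : ℝ, P0 {x | η x = c} = 0 ∧ P1 {x | η x = c} = 0)
    (ginv : ℝ → ℝ)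
    (hg : GoodG (max q (1 - q)) (gFun q η P0 P1) ginv)
    (ε : ℝ) (hε : ε ∈ Icc (0:ℝ) 1)
    (f f' : ℝ → Fin 2 → ℝ) (hf : IsClf f) (hf' : IsClf f')
    (hfair : DPD P0 P1 f ≤ ε) (hfair' : DPD P0 P1 f' ≤ ε)
    (hopt : ∀ h : ℝ → Fin 2 → ℝ, IsClf h → DPD P0 P1 h ≤ ε →
      errF q η P0 P1 f ≤ errF q η P0 P1 h)
    (hopt' : ∀ h : ℝ → Fin 2 → ℝ, IsClf h → DPD P0 P1 h ≤ ε →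
      errF q η P0 P1 f' ≤ errF q η P0 P1 h) :
    (∀ᵐ x ∂P0, f x 0 = f' x 0) ∧ ∀ᵐ x ∂P1, f x 1 = f' x 1 := by
  obtain ⟨_, hsm, _, _, hinv⟩ := hg
  have hη : Measurable η := hη_mono.monotone.measurable
  have hM : (0:ℝ) ∈ Icc (-(max q (1 - q))) (max q (1 - q)) := by
    have : q ≤ max q (1 - q) := le_max_left _ _
    constructor <;> linarith [hq.1]
  obtain ⟨lam, h1, h2⟩ : ∃ lam, |gFun q η P0 P1 lam| ≤ ε ∧
      ∀ y, |y| ≤ ε → lam * (gFun q η P0 P1 lam - y) ≤ 0 := by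
    obtain ⟨e0, e1⟩ := hε
    by_cases hc : |gFun q η P0 P1 0| ≤ ε
    · exact ⟨0, hc, fun y _ => by simp⟩
    rw [not_le, lt_abs] at hc
    rcases hc with hc | hc
    · obtain ⟨hm, hv⟩ := hinv ε ⟨by linarith, e1⟩
      refine ⟨ginv ε, by rw [hv, abs_of_nonneg e0], fun y hy => ?_⟩
      have := (hsm.lt_iff_lt hm hM).1 (by rw [hv]; exact hc)
      rw [hv]
      exact mul_nonpos_of_nonpos_of_nonneg this.le (by linarith [le_of_abs_le hy])
    · obtain ⟨hm, hv⟩ := hinv (-ε) ⟨by linarith, by linarith⟩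
      refine ⟨ginv (-ε), by rw [hv, abs_neg, abs_of_nonneg e0], fun y hy => ?_⟩
      have := (hsm.lt_iff_lt hM hm).1 (by rw [hv]; linarith)
      rw [hv]
      exact mul_nonpos_of_nonneg_of_nonpos this.le (by linarith [neg_le_of_abs_le hy])
  obtain ⟨ht, hmd⟩ := clf_aux_thresh q η hη lam P0 P1
  have hd : DPD P0 P1 (fThresh q η lam) ≤ ε := by unfold DPD; rw [hmd]; exact h1
  have A := clf_aux_main q hq P0 P1 η hη hη_mem hnull lam f hf ht (hopt _ ht hd)
    (by rw [hmd]; exact h2 _ hfair)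
  have B := clf_aux_main q hq P0 P1 η hη hη_mem hnull lam f' hf' ht (hopt' _ ht hd)
    (by rw [hmd]; exact h2 _ hfair')
  constructor
  · filter_upwards [A.1, B.1] with x a b
    rw [a, b]
  · filter_upwards [A.2, B.2] with x a b
    rw [a, b]

end
end

section
/- Let c = min(|g₀(0)|, |g₁(0)|) and define ψ : [0,c] × [0,c] → ℝ by ψ(ε₀,ε₁) = (1/4)·g₀(g₁⁻¹(sign(g₁(0))·ε₁)) + (1/4)·g₁(g₀⁻¹(sign(g₀(0))·ε₀)) + (1/4)·sign(g₀(0))·ε₀ + (1/4)·sign(g₁(0))·ε₁. Assume g₀(0)·g₁(0) < 0 and ψ(ε₀,ε₁)·(g₀(0) + g₁(0)) > 0 for all ε₀, ε₁ ∈ [0,c]. Then δ := inf{ |ψ(ε₀,ε₁)| : ε₀, ε₁ ∈ [0,c] } > 0, and for all ε₀, ε₁ ∈ [0,1] the global demographic-parity disparity of the ensemble classifier satisfies DPDisp(f_{ε₀,ε₁}^ens) ≥ δ. -/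
open MeasureTheory Set

noncomputable section

lemma integral_half {P Q : Measure ℝ} [IsProbabilityMeasure P] [IsProbabilityMeasure Q]
    {η : ℝ → ℝ} (hη : Measurable η) (s t : ℝ) :
    ∫ x, ((if η x > s then (1:ℝ) else 0) + (if η x > t then (1:ℝ) else 0)) / 2
      ∂((2:ENNReal)⁻¹ • (P + Q))
    = (1/4) * ((P {x | η x > s}).toReal + (P {x | η x > t}).toReal
      + (Q {x | η x > s}).toReal + (Q {x | η x > t}).toReal) := by
  have hm : ∀ r : ℝ, MeasurableSet {x | η x > r} := fun r => measurableSet_lt measurable_const hη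
  have hi : ∀ r : ℝ, (fun x => if η x > r then (1:ℝ) else 0)
      = Set.indicator {x | η x > r} (fun _ => (1:ℝ)) := by
    intro r; ext x; simp [Set.indicator_apply]
  have hint : ∀ (ν : Measure ℝ) [IsProbabilityMeasure ν] (r : ℝ),
      Integrable (fun x => if η x > r then (1:ℝ) else 0) ν := by
    intro ν _ r
    rw [hi r]
    exact (integrable_const (1:ℝ)).indicator (hm r)
  have hval : ∀ (ν : Measure ℝ) [IsProbabilityMeasure ν] (r : ℝ),
      (∫ x, (if η x > r then (1:ℝ) else 0) ∂ν) = (ν {x | η x > r}).toReal := by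
    intro ν _ r
    rw [hi r, integral_indicator (hm r)]
    simp [Measure.real]
  have hint2 : ∀ (ν : Measure ℝ) [IsProbabilityMeasure ν],
      Integrable (fun x => ((if η x > s then (1:ℝ) else 0) + (if η x > t then (1:ℝ) else 0)) / 2) ν :=
    fun ν _ => ((hint ν s).add (hint ν t)).div_const 2
  have hval2 : ∀ (ν : Measure ℝ) [IsProbabilityMeasure ν],
      (∫ x, ((if η x > s then (1:ℝ) else 0) + (if η x > t then (1:ℝ) else 0)) / 2 ∂ν)
        = ((ν {x | η x > s}).toReal + (ν {x | η x > t}).toReal) / 2 := by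
    intro ν _
    rw [integral_div, integral_add (hint ν s) (hint ν t), hval, hval]
  rw [integral_smul_measure, integral_add_measure (hint2 P) (hint2 Q), hval2, hval2]
  simp only [ENNReal.toReal_inv, ENNReal.toReal_ofNat, smul_eq_mul]
  ring

lemma MDF_ens (q : ℝ) (P0 P1 : Fin 2 → Measure ℝ)
    [∀ i, IsProbabilityMeasure (P0 i)] [∀ i, IsProbabilityMeasure (P1 i)]
    (η : ℝ → ℝ) (hη : Measurable η) (a b : ℝ) :
    MDF ((2:ENNReal)⁻¹ • (P0 0 + P0 1)) ((2:ENNReal)⁻¹ • (P1 0 + P1 1))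
      (fun x i => (fThresh q η a x i + fThresh q η b x i) / 2)
    = (1/4) * (gFun q η (P0 0) (P1 0) a + gFun q η (P0 0) (P1 0) b
      + gFun q η (P0 1) (P1 1) a + gFun q η (P0 1) (P1 1) b) := by
  unfold MDF fThresh gFun
  simp only [if_true, one_ne_zero, if_false]
  rw [integral_half hη, integral_half hη]
  ring

lemma abs_le_of_le {x y z : ℝ} (hx : 0 < x * z) (h : x * z ≤ y * z) : |x| ≤ |y| := by
  have hz : 0 < |z| := abs_pos.2 (by rintro rfl; simp at hx)
  have h2 : |x| * |z| ≤ |y| * |z| := by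
    rw [← abs_mul, ← abs_mul]
    exact abs_le_abs_of_nonneg hx.le h
  exact le_of_mul_le_mul_right h2 hz

/-- fundamental limitation of LFT+Ensemble (two clients): under the
stated sign conditions, the global DP disparity of the ensemble classifier is
bounded below by `δ = inf |ψ| > 0`. -/
theorem ensemble_fairness_limit
    (q : ℝ) (hq : q ∈ Ioo (0:ℝ) 1)
    (P0 P1 : Fin 2 → Measure ℝ)
    [∀ i, IsProbabilityMeasure (P0 i)] [∀ i, IsProbabilityMeasure (P1 i)]
    (η : ℝ → ℝ) (hη_mono : StrictMono η) (hη_mem : ∀ x, η x ∈ Icc (0:ℝ) 1)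
    (g : Fin 2 → ℝ → ℝ) (hgdef : ∀ i, g i = gFun q η (P0 i) (P1 i))
    (ginv : Fin 2 → ℝ → ℝ)
    (hg : ∀ i, GoodG (max q (1 - q)) (g i) (ginv i))
    (c : ℝ) (hc : c = min |g 0 0| |g 1 0|)
    (ψ : ℝ → ℝ → ℝ)
    (hψ : ∀ e0 e1, ψ e0 e1
      = (1/4) * g 0 (ginv 1 (Real.sign (g 1 0) * e1))
        + (1/4) * g 1 (ginv 0 (Real.sign (g 0 0) * e0))
        + (1/4) * Real.sign (g 0 0) * e0 + (1/4) * Real.sign (g 1 0) * e1)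
    (hopp : g 0 0 * g 1 0 < 0)
    (hpos : ∀ e0 ∈ Icc (0:ℝ) c, ∀ e1 ∈ Icc (0:ℝ) c, 0 < ψ e0 e1 * (g 0 0 + g 1 0))
    (δ : ℝ)
    (hδ : δ = sInf ((fun p : ℝ × ℝ => |ψ p.1 p.2|) '' (Icc (0:ℝ) c ×ˢ Icc (0:ℝ) c))) :
    0 < δ ∧
    ∀ e0 ∈ Icc (0:ℝ) 1, ∀ e1 ∈ Icc (0:ℝ) 1,
      δ ≤ DPD ((2:ENNReal)⁻¹ • (P0 0 + P0 1)) ((2:ENNReal)⁻¹ • (P1 0 + P1 1))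
        (fun x a =>
          (fThresh q η (ginv 0 (Real.sign (g 0 0) * min e0 |g 0 0|)) x a
            + fThresh q η (ginv 1 (Real.sign (g 1 0) * min e1 |g 1 0|)) x a) / 2) := by
  have hMnn : (0:ℝ) ∈ Icc (-(max q (1-q))) (max q (1-q)) := by
    have : 0 < max q (1-q) := lt_max_of_lt_left hq.1
    constructor <;> linarith
  have hb : ∀ i, |g i 0| ≤ 1 := by
    intro i
    have h : g i 0 ∈ Icc (-1:ℝ) 1 := (hg i).2.2.1 ▸ mem_image_of_mem _ hMnn
    exact abs_le.2 h
  have hmono : ∀ i j, MonotoneOn (fun u => g j (ginv i u)) (Icc (-1:ℝ) 1) := by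
    intro i j u hu v hv huv
    obtain ⟨hu1, hu2⟩ := (hg i).2.2.2.2 u hu
    obtain ⟨hv1, hv2⟩ := (hg i).2.2.2.2 v hv
    have : ginv i u ≤ ginv i v := by
      rw [← (hg i).2.1.le_iff_le hu1 hv1, hu2, hv2]; exact huv
    exact (hg j).2.1.monotoneOn hu1 hv1 this
  have hc0 : 0 ≤ c := by rw [hc]; exact le_min (abs_nonneg _) (abs_nonneg _)
  have key : ∃ k0 ∈ Icc (0:ℝ) c, ∃ k1 ∈ Icc (0:ℝ) c, ∀ e0 ∈ Icc (0:ℝ) |g 0 0|,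
      ∀ e1 ∈ Icc (0:ℝ) |g 1 0|, |ψ k0 k1| ≤ |ψ e0 e1| := by
    have h0 : (0:ℝ) ∈ Icc 0 c := ⟨le_rfl, hc0⟩
    have h1 : c ∈ Icc 0 c := ⟨hc0, le_rfl⟩
    have hb0 := hb 0
    have hb1 := hb 1
    have main : ∀ k0 ∈ Icc (0:ℝ) c, ∀ k1 ∈ Icc (0:ℝ) c,
        (∀ e0 ∈ Icc (0:ℝ) |g 0 0|, ∀ e1 ∈ Icc (0:ℝ) |g 1 0|,
          ψ k0 k1 * (g 0 0 + g 1 0) ≤ ψ e0 e1 * (g 0 0 + g 1 0)) →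
        ∃ k0 ∈ Icc (0:ℝ) c, ∃ k1 ∈ Icc (0:ℝ) c, ∀ e0 ∈ Icc (0:ℝ) |g 0 0|,
          ∀ e1 ∈ Icc (0:ℝ) |g 1 0|, |ψ k0 k1| ≤ |ψ e0 e1| :=
      fun k0 hk0 k1 hk1 h => ⟨k0, hk0, k1, hk1, fun e0 he0 e1 he1 =>
        abs_le_of_le (hpos k0 hk0 k1 hk1) (h e0 he0 e1 he1)⟩
    rcases mul_neg_iff.1 hopp with ⟨ha, hb'⟩ | ⟨ha, hb'⟩
    · have ea := abs_of_pos ha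
      have eb := abs_of_neg hb'
      simp only [Real.sign_of_pos ha, Real.sign_of_neg hb'] at hψ
      rcases le_total 0 (g 0 0 + g 1 0) with hs | hs
      · have hcv : c = |g 1 0| := by rw [hc]; apply min_eq_right; linarith
        refine main 0 h0 c h1 fun e0 he0 e1 he1 => mul_le_mul_of_nonneg_right ?_ hs
        have m1 := hmono 1 0 (a := -1 * c) ⟨by linarith, by linarith⟩ (b := -1 * e1)
          ⟨by linarith [he1.2], by linarith [he1.1]⟩ (by linarith [he1.2])
        have m0 := hmono 0 1 (a := 1 * 0) ⟨by linarith, by linarith⟩ (b := 1 * e0)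
          ⟨by linarith [he0.1], by linarith [he0.2]⟩ (by linarith [he0.1])
        rw [hψ, hψ]
        simp only [one_mul, neg_mul, mul_zero, neg_zero, mul_one, mul_neg] at m0 m1 ⊢
        linarith [he0.1, he1.2]
      · have hcv : c = |g 0 0| := by rw [hc]; apply min_eq_left; linarith
        refine main c h1 0 h0 fun e0 he0 e1 he1 => mul_le_mul_of_nonpos_right ?_ hs
        have m1 := hmono 1 0 (a := -1 * e1) ⟨by linarith [he1.2], by linarith [he1.1]⟩ (b := -1 * 0)
          ⟨by linarith, by linarith⟩ (by linarith [he1.1])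
        have m0 := hmono 0 1 (a := 1 * e0) ⟨by linarith [he0.1], by linarith [he0.2]⟩ (b := 1 * c)
          ⟨by linarith, by linarith⟩ (by linarith [he0.2])
        rw [hψ, hψ]
        simp only [one_mul, neg_mul, mul_zero, neg_zero, mul_one, mul_neg] at m0 m1 ⊢
        linarith [he0.2, he1.1]
    · have ea := abs_of_neg ha
      have eb := abs_of_pos hb'
      simp only [Real.sign_of_neg ha, Real.sign_of_pos hb'] at hψ
      rcases le_total 0 (g 0 0 + g 1 0) with hs | hs
      · have hcv : c = |g 0 0| := by rw [hc]; apply min_eq_left; linarith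
        refine main c h1 0 h0 fun e0 he0 e1 he1 => mul_le_mul_of_nonneg_right ?_ hs
        have m1 := hmono 1 0 (a := 1 * 0) ⟨by linarith, by linarith⟩ (b := 1 * e1)
          ⟨by linarith [he1.1], by linarith [he1.2]⟩ (by linarith [he1.1])
        have m0 := hmono 0 1 (a := -1 * c) ⟨by linarith, by linarith⟩ (b := -1 * e0)
          ⟨by linarith [he0.2], by linarith [he0.1]⟩ (by linarith [he0.2])
        rw [hψ, hψ]
        simp only [one_mul, neg_mul, mul_zero, neg_zero, mul_one, mul_neg] at m0 m1 ⊢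
        linarith [he0.2, he1.1]
      · have hcv : c = |g 1 0| := by rw [hc]; apply min_eq_right; linarith
        refine main 0 h0 c h1 fun e0 he0 e1 he1 => mul_le_mul_of_nonpos_right ?_ hs
        have m1 := hmono 1 0 (a := 1 * e1) ⟨by linarith [he1.1], by linarith [he1.2]⟩ (b := 1 * c)
          ⟨by linarith, by linarith⟩ (by linarith [he1.2])
        have m0 := hmono 0 1 (a := -1 * e0) ⟨by linarith [he0.2], by linarith [he0.1]⟩ (b := -1 * 0)
          ⟨by linarith, by linarith⟩ (by linarith [he0.1])
        rw [hψ, hψ]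
        simp only [one_mul, neg_mul, mul_zero, neg_zero, mul_one, mul_neg] at m0 m1 ⊢
        linarith [he0.1, he1.2]
  obtain ⟨k0, hk0, k1, hk1, hk⟩ := key
  have hδk : δ ≤ |ψ k0 k1| := by
    rw [hδ]
    apply csInf_le
    · refine ⟨0, ?_⟩
      rintro _ ⟨p, _, rfl⟩
      exact abs_nonneg _
    · exact ⟨(k0, k1), ⟨hk0, hk1⟩, rfl⟩
  have hcle0 : c ≤ |g 0 0| := by rw [hc]; exact min_le_left _ _
  have hcle1 : c ≤ |g 1 0| := by rw [hc]; exact min_le_right _ _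
  refine ⟨?_, ?_⟩
  · have hp : 0 < |ψ k0 k1| := by
      apply abs_pos.2
      intro h
      have := hpos k0 hk0 k1 hk1
      rw [h] at this
      simp at this
    refine lt_of_lt_of_le hp ?_
    rw [hδ]
    apply le_csInf
    · exact ⟨_, (k0, k1), ⟨hk0, hk1⟩, rfl⟩
    · rintro _ ⟨p, hpm, rfl⟩
      exact hk p.1 ⟨hpm.1.1, hpm.1.2.trans hcle0⟩ p.2 ⟨hpm.2.1, hpm.2.2.trans hcle1⟩
  · intro e0 he0 e1 he1
    have hm0 : min e0 |g 0 0| ∈ Icc (0:ℝ) |g 0 0| :=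
      ⟨le_min he0.1 (abs_nonneg _), min_le_right _ _⟩
    have hm1 : min e1 |g 1 0| ∈ Icc (0:ℝ) |g 1 0| :=
      ⟨le_min he1.1 (abs_nonneg _), min_le_right _ _⟩
    refine hδk.trans ((hk _ hm0 _ hm1).trans (le_of_eq ?_))
    have hsg : ∀ i, ∀ e ∈ Icc (0:ℝ) |g i 0|, Real.sign (g i 0) * e ∈ Icc (-1:ℝ) 1 := by
      intro i e he
      have := hb i
      have h1 := he.1
      have h2 := he.2
      rcases Real.sign_apply_eq (g i 0) with h | h | h <;> rw [h] <;>
        constructor <;> linarith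
    have i0 := ((hg 0).2.2.2.2 _ (hsg 0 _ hm0)).2
    have i1 := ((hg 1).2.2.2.2 _ (hsg 1 _ hm1)).2
    unfold DPD
    rw [MDF_ens q P0 P1 η hη_mono.monotone.measurable, ← hgdef 0, ← hgdef 1, i0, i1, hψ]
    congr 1
    ring

end
end

section
/- Under the hypotheses g₀(0)·g₁(0) < 0 and ψ(ε₀,ε₁)·(g₀(0) + g₁(0)) > 0 for all ε₀, ε₁ ∈ [0,c], where c = min(|g₀(0)|, |g₁(0)|) and ψ(ε₀,ε₁) = (1/4)·g₀(g₁⁻¹(sign(g₁(0))·ε₁)) + (1/4)·g₁(g₀⁻¹(sign(g₀(0))·ε₀)) + (1/4)·sign(g₀(0))·ε₀ + (1/4)·sign(g₁(0))·ε₁: there exists δ > 0 (namely δ = inf{|ψ| on [0,c]²}) such that DPDisp(f_{ε₀,ε₁}^ens) ≥ δ for all ε₀, ε₁ ∈ [0,1], while for every ε₀, ε₁ ∈ [0,1] the constant classifier f ≡ 1/2 satisfies the local fairness constraints |∫f(x,0)d𝒫₀^(i) − ∫f(x,1)d𝒫₁^(i)| = 0 ≤ ε_i for i = 0,1 and has global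 disparity DPDisp(f) = 0. Consequently, the infimum over ε₀, ε₁ of the ensemble's global disparity is at least δ > 0, strictly larger than the minimum global disparity 0 achievable by a classifier subject only to the local fairness constraints (the LFT+FedAvg formulation). -/
open MeasureTheory Set

noncomputable section

lemma aux_thresh_int (η : ℝ → ℝ) (hη : StrictMono η) (P : Measure ℝ) [IsProbabilityMeasure P]
    (t : ℝ) : Integrable (fun x => if η x > t then (1:ℝ) else 0) P ∧
      ∫ x, (if η x > t then (1:ℝ) else 0) ∂P = (P {x | η x > t}).toReal := by
  have hm : MeasurableSet {x | η x > t} :=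
    measurableSet_lt measurable_const hη.monotone.measurable
  have he : (fun x => if η x > t then (1:ℝ) else 0) = indicator {x | η x > t} (fun _ => (1:ℝ)) := by
    ext x
    simp [indicator]
  rw [he]
  refine ⟨(integrable_const (1:ℝ)).indicator hm, ?_⟩
  rw [integral_indicator hm]
  simp [Measure.real]

lemma aux_half_int (P Q : Measure ℝ) (f : ℝ → ℝ) (h1 : Integrable f P) (h2 : Integrable f Q) :
    ∫ x, f x ∂((2:ENNReal)⁻¹ • (P + Q)) = ((∫ x, f x ∂P) + ∫ x, f x ∂Q) / 2 := by
  rw [integral_smul_measure, integral_add_measure h1 h2]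
  simp
  ring

lemma aux_side (η : ℝ → ℝ) (hη : StrictMono η) (P Q : Measure ℝ) [IsProbabilityMeasure P]
    [IsProbabilityMeasure Q] (s t : ℝ) :
    ∫ x, ((if η x > s then (1:ℝ) else 0) + (if η x > t then (1:ℝ) else 0)) / 2
      ∂((2:ENNReal)⁻¹ • (P + Q)) =
    ((P {x | η x > s}).toReal + (P {x | η x > t}).toReal
      + (Q {x | η x > s}).toReal + (Q {x | η x > t}).toReal) / 4 := by
  obtain ⟨a1, b1⟩ := aux_thresh_int η hη P s
  obtain ⟨a2, b2⟩ := aux_thresh_int η hη P t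
  obtain ⟨a3, b3⟩ := aux_thresh_int η hη Q s
  obtain ⟨a4, b4⟩ := aux_thresh_int η hη Q t
  rw [aux_half_int _ _ (fun x => ((if η x > s then (1:ℝ) else 0) + (if η x > t then (1:ℝ) else 0)) / 2)
      ((a1.add a2).div_const 2) ((a3.add a4).div_const 2),
    integral_div, integral_div, integral_add a1 a2, integral_add a3 a4, b1, b2, b3, b4]
  ring

lemma aux_MD (q : ℝ) (η : ℝ → ℝ) (hη : StrictMono η) (P0 P1 : Fin 2 → Measure ℝ)
    [∀ i, IsProbabilityMeasure (P0 i)] [∀ i, IsProbabilityMeasure (P1 i)] (l m : ℝ) :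
    MDF ((2:ENNReal)⁻¹ • (P0 0 + P0 1)) ((2:ENNReal)⁻¹ • (P1 0 + P1 1))
      (fun x a => (fThresh q η l x a + fThresh q η m x a) / 2) =
    (gFun q η (P0 0) (P1 0) l + gFun q η (P0 0) (P1 0) m
      + gFun q η (P0 1) (P1 1) l + gFun q η (P0 1) (P1 1) m) / 4 := by
  have h0 := aux_side η hη (P0 0) (P0 1) (1/2 - l / (2*(1-q))) (1/2 - m / (2*(1-q)))
  have h1 := aux_side η hη (P1 0) (P1 1) (1/2 + l / (2*q)) (1/2 + m / (2*q))
  unfold MDF fThresh gFun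
  simp only [if_true, one_ne_zero, if_false]
  rw [h0, h1]
  ring

/-- under the sign conditions, every ensemble classifier has global
DP disparity at least `δ > 0`, while the constant classifier `1/2` satisfies all
local fairness constraints and has zero global disparity; hence the infimum of
the ensemble disparity is at least `δ`, strictly above the LFT+FedAvg optimum 0. -/
theorem ensemble_strictly_worse_than_fedavg
    (q : ℝ) (hq : q ∈ Ioo (0:ℝ) 1)
    (P0 P1 : Fin 2 → Measure ℝ)
    [∀ i, IsProbabilityMeasure (P0 i)] [∀ i, IsProbabilityMeasure (P1 i)]
    (η : ℝ → ℝ) (hη_mono : StrictMono η) (hη_mem : ∀ x, η x ∈ Icc (0:ℝ) 1)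
    (g : Fin 2 → ℝ → ℝ) (hgdef : ∀ i, g i = gFun q η (P0 i) (P1 i))
    (ginv : Fin 2 → ℝ → ℝ)
    (hg : ∀ i, GoodG (max q (1 - q)) (g i) (ginv i))
    (c : ℝ) (hc : c = min |g 0 0| |g 1 0|)
    (ψ : ℝ → ℝ → ℝ)
    (hψ : ∀ e0 e1, ψ e0 e1
      = (1/4) * g 0 (ginv 1 (Real.sign (g 1 0) * e1))
        + (1/4) * g 1 (ginv 0 (Real.sign (g 0 0) * e0))
        + (1/4) * Real.sign (g 0 0) * e0 + (1/4) * Real.sign (g 1 0) * e1)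
    (hopp : g 0 0 * g 1 0 < 0)
    (hpos : ∀ e0 ∈ Icc (0:ℝ) c, ∀ e1 ∈ Icc (0:ℝ) c, 0 < ψ e0 e1 * (g 0 0 + g 1 0))
    (δ : ℝ)
    (hδ : δ = sInf ((fun p : ℝ × ℝ => |ψ p.1 p.2|) '' (Icc (0:ℝ) c ×ˢ Icc (0:ℝ) c)))
    (fens : ℝ → ℝ → (ℝ → Fin 2 → ℝ))
    (hfens : ∀ e0 e1, fens e0 e1 = fun x a =>
      (fThresh q η (ginv 0 (Real.sign (g 0 0) * min e0 |g 0 0|)) x a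
        + fThresh q η (ginv 1 (Real.sign (g 1 0) * min e1 |g 1 0|)) x a) / 2) :
    0 < δ ∧
    (∀ e0 ∈ Icc (0:ℝ) 1, ∀ e1 ∈ Icc (0:ℝ) 1,
      δ ≤ DPD ((2:ENNReal)⁻¹ • (P0 0 + P0 1)) ((2:ENNReal)⁻¹ • (P1 0 + P1 1)) (fens e0 e1)) ∧
    (∀ e0 ∈ Icc (0:ℝ) 1, ∀ e1 ∈ Icc (0:ℝ) 1,
      (|(∫ _x, (1/2 : ℝ) ∂(P0 0)) - ∫ _x, (1/2 : ℝ) ∂(P1 0)| = 0 ∧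
        |(∫ _x, (1/2 : ℝ) ∂(P0 0)) - ∫ _x, (1/2 : ℝ) ∂(P1 0)| ≤ e0) ∧
      (|(∫ _x, (1/2 : ℝ) ∂(P0 1)) - ∫ _x, (1/2 : ℝ) ∂(P1 1)| = 0 ∧
        |(∫ _x, (1/2 : ℝ) ∂(P0 1)) - ∫ _x, (1/2 : ℝ) ∂(P1 1)| ≤ e1)) ∧
    DPD ((2:ENNReal)⁻¹ • (P0 0 + P0 1)) ((2:ENNReal)⁻¹ • (P1 0 + P1 1))
      (fun _x _a => (1/2 : ℝ)) = 0 ∧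
    δ ≤ sInf ((fun p : ℝ × ℝ =>
      DPD ((2:ENNReal)⁻¹ • (P0 0 + P0 1)) ((2:ENNReal)⁻¹ • (P1 0 + P1 1)) (fens p.1 p.2)) ''
        (Icc (0:ℝ) 1 ×ˢ Icc (0:ℝ) 1)) := by
  have hM : (0:ℝ) ∈ Icc (-(max q (1-q))) (max q (1-q)) := by
    have := le_max_left q (1-q)
    constructor <;> linarith [hq.1]
  have hmem : ∀ i, g i 0 ∈ Icc (-1:ℝ) 1 := fun i => by
    rw [← (hg i).2.2.1]
    exact mem_image_of_mem _ hM
  -- monotonicity of `g i ∘ ginv j`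
  have hmono : ∀ i j, ∀ y ∈ Icc (-1:ℝ) 1, ∀ z ∈ Icc (-1:ℝ) 1, y ≤ z →
      g i (ginv j y) ≤ g i (ginv j z) := by
    intro i j y hy z hz hyz
    obtain ⟨hy1, hy2⟩ := (hg j).2.2.2.2 y hy
    obtain ⟨hz1, hz2⟩ := (hg j).2.2.2.2 z hz
    refine (hg i).2.1.monotoneOn hy1 hz1 ?_
    rw [← (hg j).2.1.le_iff_le hy1 hz1, hy2, hz2]
    exact hyz
  have hsum : g 0 0 + g 1 0 ≠ 0 := by
    intro h
    have hc0 : 0 ≤ c := by rw [hc]; positivity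
    have := hpos 0 ⟨le_rfl, hc0⟩ 0 ⟨le_rfl, hc0⟩
    rw [h, mul_zero] at this
    exact lt_irrefl _ this
  have hc0 : 0 ≤ c := by rw [hc]; positivity
  have hne : ((fun p : ℝ × ℝ => |ψ p.1 p.2|) '' (Icc (0:ℝ) c ×ˢ Icc (0:ℝ) c)).Nonempty :=
    ⟨_, mem_image_of_mem _ (show ((0:ℝ),(0:ℝ)) ∈ _ from ⟨⟨le_rfl, hc0⟩, ⟨le_rfl, hc0⟩⟩)⟩
  have hδle : ∀ a ∈ Icc (0:ℝ) c, ∀ b ∈ Icc (0:ℝ) c, δ ≤ |ψ a b| := by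
    intro a ha b hb
    rw [hδ]
    exact csInf_le ⟨0, by rintro _ ⟨p, _, rfl⟩; exact abs_nonneg _⟩
      ⟨(a, b), ⟨ha, hb⟩, rfl⟩
  have hδpos : ∀ k : ℝ, 0 < k → (∀ a ∈ Icc (0:ℝ) c, ∀ b ∈ Icc (0:ℝ) c, k ≤ |ψ a b|) → 0 < δ := by
    intro k hk h
    rw [hδ]
    refine hk.trans_le (le_csInf hne ?_)
    rintro _ ⟨p, hp, rfl⟩
    exact h _ hp.1 _ hp.2
  have hc1 : c ≤ |g 0 0| := hc ▸ min_le_left _ _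
  have hc2 : c ≤ |g 1 0| := hc ▸ min_le_right _ _
  have h01 := hmem 0
  have h11 := hmem 1
  have habs0 : |g 0 0| ≤ 1 := abs_le.2 h01
  have habs1 : |g 1 0| ≤ 1 := abs_le.2 h11
  -- the key bound, on `[0,|g₀(0)|] × [0,|g₁(0)|]`
  have key : 0 < δ ∧ ∀ a ∈ Icc (0:ℝ) |g 0 0|, ∀ b ∈ Icc (0:ℝ) |g 1 0|, δ ≤ |ψ a b| := by
    rcases mul_neg_iff.1 hopp with ⟨hp, hn⟩ | ⟨hn, hp⟩
    · have hs0 : Real.sign (g 0 0) = 1 := Real.sign_of_pos hp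
      have hs1 : Real.sign (g 1 0) = -1 := Real.sign_of_neg hn
      rw [hs0, hs1] at hψ
      have hψm : ∀ a a' b b' : ℝ, 0 ≤ a → a ≤ a' → a' ≤ 1 → 0 ≤ b' → b' ≤ b → b ≤ 1 →
          ψ a b ≤ ψ a' b' := by
        intro a a' b b' h1 h2 h3 h4 h5 h6
        have e1 := hmono 0 1 (-1 * b) ⟨by linarith, by linarith⟩ (-1 * b')
          ⟨by linarith, by linarith⟩ (by linarith)
        have e2 := hmono 1 0 (1 * a) ⟨by linarith, by linarith⟩ (1 * a')
          ⟨by linarith, by linarith⟩ (by linarith)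
        rw [hψ, hψ]
        linarith
      rw [abs_of_pos hp] at *
      rw [abs_of_neg hn] at *
      rcases lt_or_gt_of_ne hsum with hlt | hgt
      · have hcc : c = g 0 0 := by rw [hc]; exact min_eq_left (by linarith)
        have hneg : ∀ a ∈ Icc (0:ℝ) c, ∀ b ∈ Icc (0:ℝ) c, ψ a b < 0 := fun a ha b hb =>
          neg_of_mul_pos_left (hpos a ha b hb) hlt.le
        refine ⟨hδpos (-ψ c 0) (by linarith [hneg c ⟨hc0, le_rfl⟩ 0 ⟨le_rfl, hc0⟩]) ?_, ?_⟩
        · intro a ha b hb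
          rw [abs_of_neg (hneg a ha b hb)]
          linarith [hψm a c b 0 ha.1 ha.2 (by linarith) le_rfl hb.1 (by linarith [hb.2])]
        · intro a ha b hb
          have ha' : a ∈ Icc (0:ℝ) c := hcc ▸ ha
          have hb' : min b c ∈ Icc (0:ℝ) c := ⟨le_min hb.1 hc0, min_le_right _ _⟩
          have h1 := hneg a ha' _ hb'
          have h2 := hψm a a b (min b c) ha.1 le_rfl (by linarith [ha'.2]) hb'.1 (min_le_left _ _)
            (by linarith [hb.2])
          have h3 := hδle a ha' _ hb'
          rw [abs_of_neg h1] at h3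
          rw [abs_of_neg (by linarith)]
          linarith
      · have hcc : c = -g 1 0 := by rw [hc]; exact min_eq_right (by linarith)
        have hps : ∀ a ∈ Icc (0:ℝ) c, ∀ b ∈ Icc (0:ℝ) c, 0 < ψ a b := fun a ha b hb =>
          pos_of_mul_pos_left (hpos a ha b hb) hgt.le
        refine ⟨hδpos (ψ 0 c) (hps 0 ⟨le_rfl, hc0⟩ c ⟨hc0, le_rfl⟩) ?_, ?_⟩
        · intro a ha b hb
          rw [abs_of_pos (hps a ha b hb)]
          exact hψm 0 a c b le_rfl ha.1 (by linarith [ha.2]) hb.1 hb.2 (by linarith)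
        · intro a ha b hb
          have hb' : b ∈ Icc (0:ℝ) c := hcc ▸ hb
          have ha' : min a c ∈ Icc (0:ℝ) c := ⟨le_min ha.1 hc0, min_le_right _ _⟩
          have h1 := hps _ ha' b hb'
          have h2 := hψm (min a c) a b b ha'.1 (min_le_left _ _) (by linarith [ha.2]) hb.1 le_rfl
            (by linarith [hb.2])
          have h3 := hδle _ ha' b hb'
          rw [abs_of_pos h1] at h3
          rw [abs_of_pos (by linarith)]
          linarith
    · have hs0 : Real.sign (g 0 0) = -1 := Real.sign_of_neg hn
      have hs1 : Real.sign (g 1 0) = 1 := Real.sign_of_pos hp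
      rw [hs0, hs1] at hψ
      have hψm : ∀ a a' b b' : ℝ, 0 ≤ a' → a' ≤ a → a ≤ 1 → 0 ≤ b → b ≤ b' → b' ≤ 1 →
          ψ a b ≤ ψ a' b' := by
        intro a a' b b' h1 h2 h3 h4 h5 h6
        have e1 := hmono 0 1 (1 * b) ⟨by linarith, by linarith⟩ (1 * b')
          ⟨by linarith, by linarith⟩ (by linarith)
        have e2 := hmono 1 0 (-1 * a) ⟨by linarith, by linarith⟩ (-1 * a')
          ⟨by linarith, by linarith⟩ (by linarith)
        rw [hψ, hψ]
        linarith
      rw [abs_of_pos hp] at *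
      rw [abs_of_neg hn] at *
      rcases lt_or_gt_of_ne hsum with hlt | hgt
      · have hcc : c = g 1 0 := by rw [hc]; exact min_eq_right (by linarith)
        have hneg : ∀ a ∈ Icc (0:ℝ) c, ∀ b ∈ Icc (0:ℝ) c, ψ a b < 0 := fun a ha b hb =>
          neg_of_mul_pos_left (hpos a ha b hb) hlt.le
        refine ⟨hδpos (-ψ 0 c) (by linarith [hneg 0 ⟨le_rfl, hc0⟩ c ⟨hc0, le_rfl⟩]) ?_, ?_⟩
        · intro a ha b hb
          rw [abs_of_neg (hneg a ha b hb)]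
          linarith [hψm a 0 b c le_rfl ha.1 (by linarith [ha.2]) hb.1 hb.2 (by linarith)]
        · intro a ha b hb
          have hb' : b ∈ Icc (0:ℝ) c := hcc ▸ hb
          have ha' : min a c ∈ Icc (0:ℝ) c := ⟨le_min ha.1 hc0, min_le_right _ _⟩
          have h1 := hneg _ ha' b hb'
          have h2 := hψm a (min a c) b b ha'.1 (min_le_left _ _) (by linarith [ha.2]) hb.1 le_rfl
            (by linarith [hb.2])
          have h3 := hδle _ ha' b hb'
          rw [abs_of_neg h1] at h3
          rw [abs_of_neg (by linarith)]
          linarith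
      · have hcc : c = -g 0 0 := by rw [hc]; exact min_eq_left (by linarith)
        have hps : ∀ a ∈ Icc (0:ℝ) c, ∀ b ∈ Icc (0:ℝ) c, 0 < ψ a b := fun a ha b hb =>
          pos_of_mul_pos_left (hpos a ha b hb) hgt.le
        refine ⟨hδpos (ψ c 0) (hps c ⟨hc0, le_rfl⟩ 0 ⟨le_rfl, hc0⟩) ?_, ?_⟩
        · intro a ha b hb
          rw [abs_of_pos (hps a ha b hb)]
          exact hψm c a 0 b ha.1 ha.2 (by linarith) le_rfl hb.1 (by linarith [hb.2])
        · intro a ha b hb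
          have ha' : a ∈ Icc (0:ℝ) c := hcc ▸ ha
          have hb' : min b c ∈ Icc (0:ℝ) c := ⟨le_min hb.1 hc0, min_le_right _ _⟩
          have h1 := hps a ha' _ hb'
          have h2 := hψm a a (min b c) b ha.1 le_rfl (by linarith [ha'.2]) hb'.1 (min_le_left _ _)
            (by linarith [hb.2])
          have h3 := hδle a ha' _ hb'
          rw [abs_of_pos h1] at h3
          rw [abs_of_pos (by linarith)]
          linarith
  have hens : ∀ e0 ∈ Icc (0:ℝ) 1, ∀ e1 ∈ Icc (0:ℝ) 1,
      δ ≤ DPD ((2:ENNReal)⁻¹ • (P0 0 + P0 1)) ((2:ENNReal)⁻¹ • (P1 0 + P1 1)) (fens e0 e1) := by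
    intro e0 he0 e1 he1
    have hin : ∀ i, ∀ e : ℝ, 0 ≤ e →
        g i (ginv i (Real.sign (g i 0) * min e |g i 0|)) = Real.sign (g i 0) * min e |g i 0| := by
      intro i e he
      refine ((hg i).2.2.2.2 _ ?_).2
      have h1 : |g i 0| ≤ 1 := abs_le.2 (hmem i)
      have h2 : min e |g i 0| ≤ 1 := (min_le_right _ _).trans h1
      have h3 : 0 ≤ min e |g i 0| := le_min he (abs_nonneg _)
      rcases Real.sign_apply_eq (g i 0) with h | h | h <;> rw [h] <;>
        constructor <;> linarith
    have hk := key.2 (min e0 |g 0 0|) ⟨le_min he0.1 (abs_nonneg _), min_le_right _ _⟩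
      (min e1 |g 1 0|) ⟨le_min he1.1 (abs_nonneg _), min_le_right _ _⟩
    refine hk.trans (le_of_eq ?_)
    unfold DPD
    rw [hfens, aux_MD q η hη_mono P0 P1, ← hgdef 0, ← hgdef 1, hψ, hin 0 e0 he0.1, hin 1 e1 he1.1]
    congr 1
    ring
  refine ⟨key.1, hens, ?_, ?_, ?_⟩
  · intro e0 he0 e1 he1
    simp [he0.1, he1.1]
  · unfold DPD MDF
    rw [aux_half_int _ _ _ (integrable_const _) (integrable_const _),
      aux_half_int _ _ _ (integrable_const _) (integrable_const _)]
    simp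
  · refine le_csInf ⟨_, mem_image_of_mem _ (show ((0:ℝ),(0:ℝ)) ∈ _ from
      ⟨⟨le_rfl, zero_le_one⟩, ⟨le_rfl, zero_le_one⟩⟩)⟩ ?_
    rintro _ ⟨p, hp, rfl⟩
    exact hens _ hp.1 _ hp.2

end
end

section
/- Let X be a finite set, I ≥ 1, q ∈ (0,1), η : X → [0,1], and for each i ∈ {0,…,I−1} and a ∈ {0,1} let p_a^(i) : X → [0,∞) be a probability mass function on X. For f : X × {0,1} → [0,1], define the objective J(f) = (1/I)·Σ_i [ (1−q)·Σ_{x∈X} f(x,0)(1−2η(x))p_0^(i)(x) + q·Σ_{x∈X} f(x,1)(1−2η(x))p_1^(i)(x) ] − Σ_i λ_i·( Σ_{x∈X} f(x,0)p_0^(i)(x) − Σ_{x∈X} f(x,1)p_1^(i)(x) ), where λ₀,…,λ_{I−1} ∈ ℝ. Define s_i(x,0) = 2η(x) − 1 + I·λ_i/(1−q) and s_i(x,1) = 2η(x) − 1 − I·λ_i/q. Then the classifier f*(x,a) = 1{ Σ_i s_i(x,a)·p_a^(i)(x) > 0 } minimizes J over all functions f : X × {0,1} → [0,1]. -/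
open Set

noncomputable section

/-- on a finite feature space, the per-client threshold classifier
`f*` minimizes the Lagrangian objective `J` of the LFT+FedAvg optimization over
all functions `f : X × {0,1} → [0,1]`. -/
theorem fedavg_lagrangian_threshold_optimal
    (X : Type*) [Fintype X]
    (I : ℕ) (hI : 1 ≤ I)
    (q : ℝ) (hq : q ∈ Ioo (0:ℝ) 1)
    (η : X → ℝ) (hη : ∀ x, η x ∈ Icc (0:ℝ) 1)
    (p : Fin I → Fin 2 → X → ℝ)
    (hp_nonneg : ∀ i a x, 0 ≤ p i a x)
    (hp_sum : ∀ i a, ∑ x, p i a x = 1)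
    (lam : Fin I → ℝ) :
    let J : (X → Fin 2 → ℝ) → ℝ := fun f =>
      (1 / (I:ℝ)) * ∑ i,
        ((1 - q) * ∑ x, f x 0 * (1 - 2 * η x) * p i 0 x
          + q * ∑ x, f x 1 * (1 - 2 * η x) * p i 1 x)
      - ∑ i, lam i * ((∑ x, f x 0 * p i 0 x) - ∑ x, f x 1 * p i 1 x)
    let s : Fin I → X → Fin 2 → ℝ := fun i x a =>
      if a = 0 then 2 * η x - 1 + (I:ℝ) * lam i / (1 - q)
      else 2 * η x - 1 - (I:ℝ) * lam i / q
    let fstar : X → Fin 2 → ℝ := fun x a =>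
      if 0 < ∑ i, s i x a * p i a x then 1 else 0
    ∀ f : X → Fin 2 → ℝ, (∀ x a, f x a ∈ Icc (0:ℝ) 1) → J fstar ≤ J f := by
  intro J s fstar f hf
  obtain ⟨hq0, hq1⟩ := hq
  have hI0 : (0:ℝ) < I := by exact_mod_cast hI
  have hq1' : (0:ℝ) < 1 - q := by linarith
  have key : ∀ g : X → Fin 2 → ℝ, J g =
      - ∑ x, ((1 - q) / I * (g x 0 * ∑ i, s i x 0 * p i 0 x)
        + q / I * (g x 1 * ∑ i, s i x 1 * p i 1 x)) := by
    intro g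
    have e : ∀ x, ((1 - q) / I * (g x 0 * ∑ i, s i x 0 * p i 0 x)
        + q / I * (g x 1 * ∑ i, s i x 1 * p i 1 x))
        = ∑ i, ((1 - q) / I * (g x 0 * (s i x 0 * p i 0 x))
        + q / I * (g x 1 * (s i x 1 * p i 1 x))) := by
      intro x
      simp only [Finset.mul_sum, Finset.sum_add_distrib]
    simp only [e]
    rw [Finset.sum_comm, ← Finset.sum_neg_distrib]
    simp only [J]
    rw [Finset.mul_sum, ← Finset.sum_sub_distrib]
    refine Finset.sum_congr rfl fun i _ => ?_
    rw [← Finset.sum_sub_distrib, Finset.mul_sum, Finset.mul_sum, Finset.mul_sum,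
      ← Finset.sum_add_distrib, Finset.mul_sum, ← Finset.sum_sub_distrib,
      ← Finset.sum_neg_distrib]
    refine Finset.sum_congr rfl fun x _ => ?_
    simp only [s, if_true, one_ne_zero, if_false]
    field_simp
    ring
  have opt : ∀ x a, f x a * ∑ i, s i x a * p i a x ≤ fstar x a * ∑ i, s i x a * p i a x := by
    intro x a
    obtain ⟨h0, h1⟩ := hf x a
    simp only [fstar]
    split_ifs with h
    · exact mul_le_mul_of_nonneg_right h1 h.le
    · rw [zero_mul]
      exact mul_nonpos_of_nonneg_of_nonpos h0 (not_lt.mp h)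
  rw [key, key]
  refine neg_le_neg (Finset.sum_le_sum fun x _ => ?_)
  exact add_le_add (mul_le_mul_of_nonneg_left (opt x 0) (by positivity))
    (mul_le_mul_of_nonneg_left (opt x 1) (by positivity))

end
end

section
/- Let S be a nonempty finite set of samples with label map y : S → {0,1}, group map a : S → {0,…,A−1} (A ≥ 1), and prediction map ŷ : S → {0,1}. Assume n_{y',a'} := #{s ∈ S : y(s)=y', a(s)=a'} ≥ 1 for all y' ∈ {0,1} and a' ∈ {0,…,A−1}, and set n_{⋆,a'} = #{s ∈ S : a(s)=a'}. Using the 0-1 loss, define L_{y',a'} = (1/n_{y',a'})·Σ_{s : y(s)=y', a(s)=a'} 1{y(s) ≠ ŷ(s)}, L'_{y',a'} = (n_{y',a'}/n_{⋆,a'})·L_{y',a'}, and for each a' ∈ {0,…,A−1}: F_{a'} = −L'_{0,0} + L'_{1,0} + L'_{0,a'} − L'_{1,a'} + n_{0,0}/n_{⋆,0} − n_{0,a'}/n_{⋆,a'}. Then F_{a'} = 0 for all a' ∈ {0,…,A−1} if and only if demographic parity holds, i.e., the empirical positive rate #{s : ŷ(s)=1, a(s)=a'}/n_{⋆,a'}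 is the same for every group a'. -/
open Finset

noncomputable section

/-- on a finite dataset, the FairBatch quantities `F_{a'}` all vanish
if and only if demographic parity holds (all groups have the same empirical
positive rate). -/
theorem fairbatch_dp_condition
    (S : Type*) [Fintype S] [Nonempty S]
    (A : ℕ) [NeZero A] (hA : 1 ≤ A)
    (y : S → Fin 2) (a : S → Fin A) (yhat : S → Fin 2)
    (hcount : ∀ (y' : Fin 2) (a' : Fin A),
      1 ≤ (Finset.univ.filter fun s => y s = y' ∧ a s = a').card) :
    let n : Fin 2 → Fin A → ℝ := fun y' a' =>
      ((Finset.univ.filter fun s => y s = y' ∧ a s = a').card : ℝ)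
    let nstar : Fin A → ℝ := fun a' => ((Finset.univ.filter fun s => a s = a').card : ℝ)
    let L : Fin 2 → Fin A → ℝ := fun y' a' =>
      (1 / n y' a') *
        ∑ s ∈ Finset.univ.filter (fun s => y s = y' ∧ a s = a'),
          (if y s ≠ yhat s then (1:ℝ) else 0)
    let L' : Fin 2 → Fin A → ℝ := fun y' a' => (n y' a' / nstar a') * L y' a'
    let F : Fin A → ℝ := fun a' =>
      -L' 0 0 + L' 1 0 + L' 0 a' - L' 1 a' + n 0 0 / nstar 0 - n 0 a' / nstar a'
    let posRate : Fin A → ℝ := fun a' =>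
      ((Finset.univ.filter fun s => yhat s = 1 ∧ a s = a').card : ℝ) / nstar a'
    ((∀ a', F a' = 0) ↔ ∀ a' a'', posRate a' = posRate a'') := by
  intro n nstar L L' F posRate
  have hn : ∀ y' a', n y' a' ≠ 0 := by
    intro y' a'
    have h := hcount y' a'
    simp only [n]
    exact Nat.cast_ne_zero.mpr (by omega)
  have hs : ∀ a', nstar a' ≠ 0 := by
    intro a'
    have h := hcount 0 a'
    have h2 : (Finset.univ.filter fun s => y s = 0 ∧ a s = a').card ≤
        (Finset.univ.filter fun s => a s = a').card := by
      apply Finset.card_le_card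
      intro s hs
      simp only [Finset.mem_filter] at hs ⊢
      exact ⟨hs.1, hs.2.2⟩
    simp only [nstar]
    exact Nat.cast_ne_zero.mpr (by omega)
  have hL : ∀ y' a', L' y' a' =
      (∑ s ∈ Finset.univ.filter (fun s => y s = y' ∧ a s = a'),
          (if y s ≠ yhat s then (1:ℝ) else 0)) / nstar a' := by
    intro y' a'
    have h1 := hn y' a'
    have h2 := hs a'
    simp only [L', L]
    field_simp
  have hc : ∀ a', ((Finset.univ.filter fun s => yhat s = 1 ∧ a s = a').card : ℝ) =
      (∑ s ∈ Finset.univ.filter (fun s => y s = 0 ∧ a s = a'),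
          (if y s ≠ yhat s then (1:ℝ) else 0)) -
      (∑ s ∈ Finset.univ.filter (fun s => y s = 1 ∧ a s = a'),
          (if y s ≠ yhat s then (1:ℝ) else 0)) + nstar a' - n 0 a' := by
    intro a'
    simp only [nstar, n, Finset.card_filter, Nat.cast_sum, Finset.sum_filter]
    rw [← Finset.sum_sub_distrib, ← Finset.sum_add_distrib, ← Finset.sum_sub_distrib]
    refine Finset.sum_congr rfl fun s _ => ?_
    have two : ∀ x : Fin 2, x = 0 ∨ x = 1 := by decide
    by_cases ha : a s = a' <;> rcases two (y s) with h | h <;>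
      rcases two (yhat s) with h' | h' <;> simp [ha, h, h']
  have hp : ∀ a', posRate a' = L' 0 a' - L' 1 a' + 1 - n 0 a' / nstar a' := by
    intro a'
    have h2 := hs a'
    simp only [posRate]
    rw [hc a', hL, hL]
    field_simp
  have hF : ∀ a', F a' = posRate a' - posRate 0 := by
    intro a'
    rw [hp, hp]
    simp only [F]
    ring
  constructor
  · intro h a' a''
    have h1 := h a'
    have h2 := h a''
    rw [hF] at h1 h2
    linarith
  · intro h a'
    rw [hF, h a' 0, sub_self]

end
end

section
/- Let c = min(|g̃₀(0)|, |g̃₁(0)|) and define ψ̃ : [0,c] × [0,c] → ℝ by ψ̃(ε₀,ε₁) = J₀J₁·g̃₀(g̃₁⁻¹(sign(g̃₁(0))·ε₁)) + J₀J₁·g̃₁(g̃₀⁻¹(sign(g̃₀(0))·ε₀)) + J₀²·sign(g̃₀(0))·ε₀ + J₁²·sign(g̃₁(0))·ε₁. Assume g̃₀(0)·g̃₁(0) < 0 and ψ̃(ε₀,ε₁)·(g̃₀(0) + g̃₁(0)) > 0 for all ε₀, ε₁ ∈ [0,c]. Then δ̃ := inf{ |ψ̃(ε₀,ε₁)| :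 ε₀, ε₁ ∈ [0,c] } > 0, and for all ε₀, ε₁ ∈ [0,1] the global demographic-parity disparity of the weighted ensemble classifier satisfies DPDisp(J₀·f̃₀^{ε₀} + J₁·f̃₁^{ε₁}) ≥ δ̃. -/
open MeasureTheory Set

noncomputable section

lemma aux_int (q : ℝ) (η : ℝ → ℝ) (hη : StrictMono η) (lam : ℝ) (P : Measure ℝ)
    [IsProbabilityMeasure P] (a : Fin 2) : Integrable (fun x => fThresh q η lam x a) P := by
  have hm : Measurable η := hη.monotone.measurable
  refine Integrable.of_bound (C := 1) ?_ ?_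
  · apply Measurable.aestronglyMeasurable
    unfold fThresh
    split_ifs
    · exact Measurable.ite (measurableSet_lt measurable_const hm) measurable_const measurable_const
    · exact Measurable.ite (measurableSet_lt measurable_const hm) measurable_const measurable_const
  · refine Filter.Eventually.of_forall fun x => ?_
    unfold fThresh
    split_ifs <;> simp

lemma aux_val (q : ℝ) (η : ℝ → ℝ) (hη : StrictMono η) (lam : ℝ) (P Q : Measure ℝ) :
    (∫ x, fThresh q η lam x 0 ∂P) - (∫ x, fThresh q η lam x 1 ∂Q) = gFun q η P Q lam := by
  have hm : Measurable η := hη.monotone.measurable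
  have key : ∀ (t : ℝ) (ν : Measure ℝ), (∫ x, (if η x > t then (1:ℝ) else 0) ∂ν)
      = (ν {x | η x > t}).toReal := by
    intro t ν
    have := integral_indicator_one (μ := ν) (s := {x | η x > t})
      (measurableSet_lt measurable_const hm)
    rw [Measure.real] at this
    rw [← this]
    rfl
  simp only [fThresh, gFun, if_true, one_ne_zero, if_false, key]

lemma aux_md (q : ℝ) (η : ℝ → ℝ) (hη : StrictMono η) (J0 J1 : ℝ) (hJ0 : 0 < J0) (hJ1 : 0 < J1)
    (P0 P1 : Fin 2 → Measure ℝ)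
    [∀ j, IsProbabilityMeasure (P0 j)] [∀ j, IsProbabilityMeasure (P1 j)] (l0 l1 : ℝ) :
    MDF (ENNReal.ofReal J0 • P0 0 + ENNReal.ofReal J1 • P0 1)
          (ENNReal.ofReal J0 • P1 0 + ENNReal.ofReal J1 • P1 1)
        (fun x a => J0 * fThresh q η l0 x a + J1 * fThresh q η l1 x a)
    = J0 * J1 * gFun q η (P0 0) (P1 0) l1 + J0 * J1 * gFun q η (P0 1) (P1 1) l0
      + J0 ^ 2 * gFun q η (P0 0) (P1 0) l0 + J1 ^ 2 * gFun q η (P0 1) (P1 1) l1 := by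
  have key : ∀ (P : Fin 2 → Measure ℝ) [∀ j, IsProbabilityMeasure (P j)] (a : Fin 2),
      (∫ x, (J0 * fThresh q η l0 x a + J1 * fThresh q η l1 x a)
        ∂(ENNReal.ofReal J0 • P 0 + ENNReal.ofReal J1 • P 1))
      = J0 * (J0 * (∫ x, fThresh q η l0 x a ∂(P 0)) + J1 * (∫ x, fThresh q η l1 x a ∂(P 0)))
       + J1 * (J0 * (∫ x, fThresh q η l0 x a ∂(P 1)) + J1 * (∫ x, fThresh q η l1 x a ∂(P 1))) := by
    intro P _ a
    have hi : ∀ j, Integrable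
        (fun x => J0 * fThresh q η l0 x a + J1 * fThresh q η l1 x a) (P j) := fun j =>
      ((aux_int q η hη l0 (P j) a).const_mul J0).add ((aux_int q η hη l1 (P j) a).const_mul J1)
    have hv : ∀ j, (∫ x, (J0 * fThresh q η l0 x a + J1 * fThresh q η l1 x a) ∂(P j))
        = J0 * (∫ x, fThresh q η l0 x a ∂(P j)) + J1 * (∫ x, fThresh q η l1 x a ∂(P j)) := by
      intro j
      rw [integral_add ((aux_int q η hη l0 (P j) a).const_mul J0)
        ((aux_int q η hη l1 (P j) a).const_mul J1), integral_const_mul, integral_const_mul]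
    rw [integral_add_measure ((hi 0).smul_measure ENNReal.ofReal_ne_top)
      ((hi 1).smul_measure ENNReal.ofReal_ne_top), integral_smul_measure, integral_smul_measure,
      hv, hv, ENNReal.toReal_ofReal hJ0.le, ENNReal.toReal_ofReal hJ1.le, smul_eq_mul, smul_eq_mul]
  unfold MDF
  rw [key P0 0, key P1 1]
  simp only [← aux_val q η hη]
  ring

lemma aux_mono {M : ℝ} {g ginv h hinv : ℝ → ℝ} (hg : GoodG M g ginv) (hh : GoodG M h hinv)
    {y z : ℝ} (hy : y ∈ Icc (-1:ℝ) 1) (hz : z ∈ Icc (-1:ℝ) 1) (hyz : y ≤ z) :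
    h (ginv y) ≤ h (ginv z) := by
  obtain ⟨hy1, hy2⟩ := hg.2.2.2.2 y hy
  obtain ⟨hz1, hz2⟩ := hg.2.2.2.2 z hz
  refine hh.2.1.monotoneOn hy1 hz1 ?_
  rw [← hg.2.1.le_iff_le hy1 hz1, hy2, hz2]
  exact hyz

/-- multi-client (two-subset, weighted) version of the LFT+Ensemble
fairness limitation: under the stated sign conditions, the global DP disparity of
the weighted ensemble classifier is bounded below by `δ̃ = inf |ψ̃| > 0`. -/
theorem weighted_ensemble_fairness_limit
    (q : ℝ) (hq : q ∈ Ioo (0:ℝ) 1)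
    (J0 J1 : ℝ) (hJ0 : 0 < J0) (hJ1 : 0 < J1) (hJ : J0 + J1 = 1)
    (P0 P1 : Fin 2 → Measure ℝ)
    [∀ j, IsProbabilityMeasure (P0 j)] [∀ j, IsProbabilityMeasure (P1 j)]
    (η : ℝ → ℝ) (hη_mono : StrictMono η) (hη_mem : ∀ x, η x ∈ Icc (0:ℝ) 1)
    (g : Fin 2 → ℝ → ℝ) (hgdef : ∀ j, g j = gFun q η (P0 j) (P1 j))
    (ginv : Fin 2 → ℝ → ℝ)
    (hg : ∀ j, GoodG (max q (1 - q)) (g j) (ginv j))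
    (c : ℝ) (hc : c = min |g 0 0| |g 1 0|)
    (ψ : ℝ → ℝ → ℝ)
    (hψ : ∀ e0 e1, ψ e0 e1
      = J0 * J1 * g 0 (ginv 1 (Real.sign (g 1 0) * e1))
        + J0 * J1 * g 1 (ginv 0 (Real.sign (g 0 0) * e0))
        + J0 ^ 2 * Real.sign (g 0 0) * e0 + J1 ^ 2 * Real.sign (g 1 0) * e1)
    (hopp : g 0 0 * g 1 0 < 0)
    (hpos : ∀ e0 ∈ Icc (0:ℝ) c, ∀ e1 ∈ Icc (0:ℝ) c, 0 < ψ e0 e1 * (g 0 0 + g 1 0))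
    (δ : ℝ)
    (hδ : δ = sInf ((fun p : ℝ × ℝ => |ψ p.1 p.2|) '' (Icc (0:ℝ) c ×ˢ Icc (0:ℝ) c))) :
    0 < δ ∧
    ∀ e0 ∈ Icc (0:ℝ) 1, ∀ e1 ∈ Icc (0:ℝ) 1,
      δ ≤ DPD (ENNReal.ofReal J0 • P0 0 + ENNReal.ofReal J1 • P0 1)
          (ENNReal.ofReal J0 • P1 0 + ENNReal.ofReal J1 • P1 1)
        (fun x a =>
          J0 * fThresh q η (ginv 0 (Real.sign (g 0 0) * min e0 |g 0 0|)) x a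
            + J1 * fThresh q η (ginv 1 (Real.sign (g 1 0) * min e1 |g 1 0|)) x a) := by
  have hM : (0:ℝ) ∈ Icc (-(max q (1 - q))) (max q (1 - q)) := by
    have : 0 < max q (1 - q) := lt_max_of_lt_left hq.1
    constructor <;> linarith
  have hb : ∀ j, g j 0 ∈ Icc (-1:ℝ) 1 := fun j => by
    rw [← (hg j).2.2.1]; exact mem_image_of_mem _ hM
  have hb0 := hb 0
  have hb1 := hb 1
  have hJJ : 0 < J0 * J1 := mul_pos hJ0 hJ1
  have hJ00 : 0 < J0 ^ 2 := by positivity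
  have hJ11 : 0 < J1 ^ 2 := by positivity
  have main : ∃ p0 ∈ Icc (0:ℝ) c, ∃ p1 ∈ Icc (0:ℝ) c,
      ∀ e0 ∈ Icc (0:ℝ) |g 0 0|, ∀ e1 ∈ Icc (0:ℝ) |g 1 0|, |ψ p0 p1| ≤ |ψ e0 e1| := by
    have m01 : ∀ y ∈ Icc (-1:ℝ) 1, ∀ z ∈ Icc (-1:ℝ) 1, y ≤ z →
        J0 * J1 * g 1 (ginv 0 y) ≤ J0 * J1 * g 1 (ginv 0 z) := fun y hy z hz h =>
      mul_le_mul_of_nonneg_left (aux_mono (hg 0) (hg 1) hy hz h) hJJ.le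
    have m10 : ∀ y ∈ Icc (-1:ℝ) 1, ∀ z ∈ Icc (-1:ℝ) 1, y ≤ z →
        J0 * J1 * g 0 (ginv 1 y) ≤ J0 * J1 * g 0 (ginv 1 z) := fun y hy z hz h =>
      mul_le_mul_of_nonneg_left (aux_mono (hg 1) (hg 0) hy hz h) hJJ.le
    have hc0 : 0 ≤ c := hc ▸ le_min (abs_nonneg _) (abs_nonneg _)
    have h0c : (0:ℝ) ∈ Icc (0:ℝ) c := ⟨le_rfl, hc0⟩
    have hcc : c ∈ Icc (0:ℝ) c := ⟨hc0, le_rfl⟩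
    have hne : g 0 0 + g 1 0 ≠ 0 := fun h => by
      have := hpos 0 h0c 0 h0c
      rw [h, mul_zero] at this
      exact lt_irrefl _ this
    have hp1 := hpos 0 h0c c hcc
    have hp2 := hpos c hcc 0 h0c
    obtain ⟨hb0l, hb0r⟩ := hb0
    obtain ⟨hb1l, hb1r⟩ := hb1
    rcases mul_neg_iff.1 hopp with ⟨hA, hB⟩ | ⟨hA, hB⟩
    · rw [abs_of_pos hA, abs_of_neg hB] at hc ⊢
      simp only [hψ, Real.sign_of_pos hA, Real.sign_of_neg hB] at hp1 hp2 ⊢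
      rcases lt_or_gt_of_ne hne with hs | hs
      · have hcv : c = g 0 0 := by rw [hc]; exact min_eq_left (by linarith)
        refine ⟨c, hcc, 0, h0c, fun e0 he0 e1 he1 => ?_⟩
        obtain ⟨u0, v0⟩ := he0
        obtain ⟨u1, v1⟩ := he1
        have n := neg_of_mul_pos_left hp2 hs.le
        refine abs_le_abs_of_nonpos n.le ?_
        have a1 := m01 (1 * e0) ⟨by linarith, by linarith⟩ (1 * c) ⟨by linarith, by linarith⟩
          (by linarith)
        have a2 := m10 (-1 * e1) ⟨by linarith, by linarith⟩ (-1 * 0) ⟨by linarith, by linarith⟩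
          (by linarith)
        have a3 : J0 ^ 2 * e0 ≤ J0 ^ 2 * c := mul_le_mul_of_nonneg_left (by linarith) hJ00.le
        have a4 : 0 ≤ J1 ^ 2 * e1 := mul_nonneg hJ11.le u1
        linarith
      · have hcv : c = -g 1 0 := by rw [hc]; exact min_eq_right (by linarith)
        refine ⟨0, h0c, c, hcc, fun e0 he0 e1 he1 => ?_⟩
        obtain ⟨u0, v0⟩ := he0
        obtain ⟨u1, v1⟩ := he1
        have n := pos_of_mul_pos_left hp1 hs.le
        refine abs_le_abs_of_nonneg n.le ?_
        have a1 := m01 (1 * 0) ⟨by linarith, by linarith⟩ (1 * e0) ⟨by linarith, by linarith⟩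
          (by linarith)
        have a2 := m10 (-1 * c) ⟨by linarith, by linarith⟩ (-1 * e1) ⟨by linarith, by linarith⟩
          (by linarith)
        have a3 : 0 ≤ J0 ^ 2 * e0 := mul_nonneg hJ00.le u0
        have a4 : J1 ^ 2 * e1 ≤ J1 ^ 2 * c := mul_le_mul_of_nonneg_left (by linarith) hJ11.le
        linarith
    · rw [abs_of_neg hA, abs_of_pos hB] at hc ⊢
      simp only [hψ, Real.sign_of_neg hA, Real.sign_of_pos hB] at hp1 hp2 ⊢
      rcases lt_or_gt_of_ne hne with hs | hs
      · have hcv : c = g 1 0 := by rw [hc]; exact min_eq_right (by linarith)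
        refine ⟨0, h0c, c, hcc, fun e0 he0 e1 he1 => ?_⟩
        obtain ⟨u0, v0⟩ := he0
        obtain ⟨u1, v1⟩ := he1
        have n := neg_of_mul_pos_left hp1 hs.le
        refine abs_le_abs_of_nonpos n.le ?_
        have a1 := m01 (-1 * e0) ⟨by linarith, by linarith⟩ (-1 * 0) ⟨by linarith, by linarith⟩
          (by linarith)
        have a2 := m10 (1 * e1) ⟨by linarith, by linarith⟩ (1 * c) ⟨by linarith, by linarith⟩
          (by linarith)
        have a3 : 0 ≤ J0 ^ 2 * e0 := mul_nonneg hJ00.le u0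
        have a4 : J1 ^ 2 * e1 ≤ J1 ^ 2 * c := mul_le_mul_of_nonneg_left (by linarith) hJ11.le
        linarith
      · have hcv : c = -g 0 0 := by rw [hc]; exact min_eq_left (by linarith)
        refine ⟨c, hcc, 0, h0c, fun e0 he0 e1 he1 => ?_⟩
        obtain ⟨u0, v0⟩ := he0
        obtain ⟨u1, v1⟩ := he1
        have n := pos_of_mul_pos_left hp2 hs.le
        refine abs_le_abs_of_nonneg n.le ?_
        have a1 := m01 (-1 * c) ⟨by linarith, by linarith⟩ (-1 * e0) ⟨by linarith, by linarith⟩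
          (by linarith)
        have a2 := m10 (1 * 0) ⟨by linarith, by linarith⟩ (1 * e1) ⟨by linarith, by linarith⟩
          (by linarith)
        have a3 : J0 ^ 2 * e0 ≤ J0 ^ 2 * c := mul_le_mul_of_nonneg_left (by linarith) hJ00.le
        have a4 : 0 ≤ J1 ^ 2 * e1 := mul_nonneg hJ11.le u1
        linarith
  obtain ⟨p0, hp0, p1, hp1, hmin⟩ := main
  have hle : δ ≤ |ψ p0 p1| := by
    rw [hδ]
    refine csInf_le ⟨0, ?_⟩ ⟨(p0, p1), ⟨hp0, hp1⟩, rfl⟩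
    rintro _ ⟨p, _, rfl⟩
    exact abs_nonneg _
  have hge : |ψ p0 p1| ≤ δ := by
    rw [hδ]
    refine le_csInf ⟨_, ⟨(p0, p1), ⟨hp0, hp1⟩, rfl⟩⟩ ?_
    rintro _ ⟨p, ⟨h0, h1⟩, rfl⟩
    exact hmin _ ⟨h0.1, h0.2.trans (hc ▸ min_le_left _ _)⟩ _
      ⟨h1.1, h1.2.trans (hc ▸ min_le_right _ _)⟩
  refine ⟨lt_of_lt_of_le (abs_pos.2 fun h => ?_) hge, fun e0 he0 e1 he1 => ?_⟩
  · have := hpos p0 hp0 p1 hp1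
    rw [h, zero_mul] at this
    exact lt_irrefl _ this
  · have hin : ∀ j, ∀ e ∈ Icc (0:ℝ) 1,
        g j (ginv j (Real.sign (g j 0) * min e |g j 0|)) = Real.sign (g j 0) * min e |g j 0| := by
      intro j e he
      refine ((hg j).2.2.2.2 _ ?_).2
      have h1 : min e |g j 0| ≤ 1 := (min_le_left _ _).trans he.2
      have h0 : 0 ≤ min e |g j 0| := le_min he.1 (abs_nonneg _)
      rcases Real.sign_apply_eq (g j 0) with h | h | h <;> rw [h] <;> constructor <;> linarith
    have heq := aux_md q η hη_mono J0 J1 hJ0 hJ1 P0 P1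
      (ginv 0 (Real.sign (g 0 0) * min e0 |g 0 0|)) (ginv 1 (Real.sign (g 1 0) * min e1 |g 1 0|))
    rw [← hgdef 0, ← hgdef 1, hin 0 e0 he0, hin 1 e1 he1, ← mul_assoc, ← mul_assoc,
      ← hψ] at heq
    rw [DPD, heq]
    exact hle.trans (hmin _ ⟨le_min he0.1 (abs_nonneg _), min_le_right _ _⟩ _
      ⟨le_min he1.1 (abs_nonneg _), min_le_right _ _⟩)

end
end

section
/- Let ε, ε₀, ε₁ ∈ [0,1] and suppose DPDisp(f_{ε₀,ε₁}^ens) ≤ ε. Then err(f_{ε₀,ε₁}^ens) ≥ err(f_ε^CFL), and equality err(f_{ε₀,ε₁}^ens) = err(f_ε^CFL) holds if and only if λ_{ε₀}^(0) = λ_{ε₁}^(1) = λ_ε. -/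
open MeasureTheory Set

noncomputable section

theorem aux_int_s16 (Q : Measure ℝ) [IsFiniteMeasure Q] (h : ℝ → ℝ) (hm : Measurable h) (C : ℝ)
    (hC : ∀ x, |h x| ≤ C) : Integrable h Q :=
  Integrable.of_bound hm.aestronglyMeasurable C (Filter.Eventually.of_forall hC)

/-- One group: decomposition of the error difference. -/
theorem aux_group (Q : Measure ℝ) [IsFiniteMeasure Q] (η f t : ℝ → ℝ) (hη : Measurable η)
    (hηm : ∀ x, η x ∈ Icc (0:ℝ) 1) (hf : Measurable f) (hfm : ∀ x, f x ∈ Icc (0:ℝ) 1)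
    (ht : Measurable t) (htm : ∀ x, t x ∈ Icc (0:ℝ) 1) (w c : ℝ) :
    Integrable (fun x => (f x - t x) * (w * (1 - 2 * η x) - c)) Q ∧
    w * (∫ x, (f x * (1 - η x) + (1 - f x) * η x) ∂Q)
      - w * (∫ x, (t x * (1 - η x) + (1 - t x) * η x) ∂Q)
      = c * ((∫ x, f x ∂Q) - ∫ x, t x ∂Q)
        + ∫ x, (f x - t x) * (w * (1 - 2 * η x) - c) ∂Q := by
  have e : ∀ u : ℝ → ℝ, Measurable u → (∀ x, u x ∈ Icc (0:ℝ) 1) →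
      Integrable (fun x => u x * (1 - η x) + (1 - u x) * η x) Q := by
    intro u hu hum
    refine aux_int_s16 Q _ (by fun_prop) 1 ?_
    intro x
    obtain ⟨a, b⟩ := hum x
    obtain ⟨a', b'⟩ := hηm x
    rw [abs_le]
    constructor <;> nlinarith [mul_nonneg a a', mul_nonneg a (sub_nonneg.2 b'),
      mul_nonneg (sub_nonneg.2 b) a', mul_nonneg (sub_nonneg.2 b) (sub_nonneg.2 b')]
  have e' : ∀ u : ℝ → ℝ, Measurable u → (∀ x, u x ∈ Icc (0:ℝ) 1) → Integrable u Q := by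
    intro u hu hum
    refine aux_int_s16 Q _ hu 1 ?_
    intro x
    obtain ⟨a, b⟩ := hum x
    rw [abs_le]
    constructor <;> linarith
  have i1 := e f hf hfm
  have i2 := e t ht htm
  have i3 := e' f hf hfm
  have i4 := e' t ht htm
  have key : (fun x => (f x - t x) * (w * (1 - 2 * η x) - c)) =
      fun x => w * ((f x * (1 - η x) + (1 - f x) * η x) - (t x * (1 - η x) + (1 - t x) * η x))
        - c * (f x - t x) := by
    funext x; ring
  constructor
  · rw [key]
    exact ((i1.sub i2).const_mul w).sub ((i3.sub i4).const_mul c)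
  · have h1 : ∫ x, (f x - t x) * (w * (1 - 2 * η x) - c) ∂Q =
        w * ((∫ x, (f x * (1 - η x) + (1 - f x) * η x) ∂Q)
          - ∫ x, (t x * (1 - η x) + (1 - t x) * η x) ∂Q)
        - c * ((∫ x, f x ∂Q) - ∫ x, t x ∂Q) := by
      have j1 : Integrable (fun x => w * ((f x * (1 - η x) + (1 - f x) * η x)
          - (t x * (1 - η x) + (1 - t x) * η x))) Q := (i1.sub i2).const_mul w
      have j2 : Integrable (fun x => c * (f x - t x)) Q := (i3.sub i4).const_mul c
      rw [key, integral_sub j1 j2, integral_const_mul, integral_const_mul, integral_sub i1 i2, integral_sub i3 i4]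
    rw [h1]; ring

theorem aux_thresh_mem (q : ℝ) (η : ℝ → ℝ) (l x : ℝ) (a : Fin 2) :
    fThresh q η l x a = 0 ∨ fThresh q η l x a = 1 := by
  unfold fThresh
  split_ifs <;> simp

theorem aux_thresh_meas (q : ℝ) (η : ℝ → ℝ) (hη : Measurable η) (l : ℝ) (a : Fin 2) :
    Measurable fun x => fThresh q η l x a := by
  unfold fThresh
  split_ifs
  · exact Measurable.ite (measurableSet_lt measurable_const hη) measurable_const measurable_const
  · exact Measurable.ite (measurableSet_lt measurable_const hη) measurable_const measurable_const

theorem aux_MD_s16 (q : ℝ) (η : ℝ → ℝ) (hη : Measurable η) (Q0 Q1 : Measure ℝ) (l : ℝ) :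
    MDF Q0 Q1 (fThresh q η l) = gFun q η Q0 Q1 l := by
  have h : ∀ (Q : Measure ℝ) (c : ℝ),
      ∫ x, (if η x > c then (1:ℝ) else 0) ∂Q = (Q {x | η x > c}).toReal := by
    intro Q c
    have : (fun x => if η x > c then (1:ℝ) else 0) = indicator {x | η x > c} 1 := by
      funext x; simp [indicator]
    rw [this, integral_indicator_one (measurableSet_lt measurable_const hη)]
    rfl
  unfold MDF gFun fThresh
  simp [h]

theorem aux_sign (e y : ℝ) (he : e ∈ Icc (0:ℝ) 1) : Real.sign y * min e |y| ∈ Icc (-1:ℝ) 1 := by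
  have h1 : 0 ≤ min e |y| := le_min he.1 (abs_nonneg _)
  have h2 : min e |y| ≤ 1 := (min_le_left _ _).trans he.2
  rcases Real.sign_apply_eq y with h | h | h <;> rw [h] <;> constructor <;> linarith

theorem aux_lam (M : ℝ) (hM : 0 < M) (g ginv : ℝ → ℝ) (hg : GoodG M g ginv) (e l m : ℝ)
    (he : e ∈ Icc (0:ℝ) 1) (hl : l = ginv (Real.sign (g 0) * min e |g 0|)) (hm : |m| ≤ e) :
    0 ≤ l * (m - g l) := by
  obtain ⟨-, hmono, -, -, hinv⟩ := hg
  obtain ⟨hlM, hgl⟩ := hinv _ (aux_sign e (g 0) he)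
  rw [← hl] at hlM hgl
  have h0 : (0:ℝ) ∈ Icc (-M) M := ⟨by linarith, hM.le⟩
  obtain ⟨m1, m2⟩ := abs_le.1 hm
  rcases lt_trichotomy l 0 with h | h | h
  · have hlt := hmono hlM h0 h
    rcases lt_trichotomy (g 0) 0 with k | k | k
    · exfalso
      rw [Real.sign_of_neg k, abs_of_neg k] at hgl
      have := min_le_right e (-g 0)
      linarith
    · rw [k] at hgl hlt; simp at hgl; linarith
    · rw [Real.sign_of_pos k, abs_of_pos k] at hgl
      have : g l = e := by
        rcases min_choice e (g 0) with r | r <;> rw [r] at hgl <;> linarith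
      exact mul_nonneg_of_nonpos_of_nonpos h.le (by linarith)
  · rw [h]; simp
  · have hlt := hmono h0 hlM h
    rcases lt_trichotomy (g 0) 0 with k | k | k
    · rw [Real.sign_of_neg k, abs_of_neg k] at hgl
      have : g l = -e := by
        rcases min_choice e (-g 0) with r | r <;> rw [r] at hgl <;> linarith
      exact mul_nonneg h.le (by linarith)
    · rw [k] at hgl hlt; simp at hgl; linarith
    · exfalso
      rw [Real.sign_of_pos k, abs_of_pos k] at hgl
      have := min_le_right e (g 0)
      linarith

/-- almost everywhere equality from vanishing of the excess risk -/
theorem aux_ae (Q : Measure ℝ) (η f t : ℝ → ℝ) (w c : ℝ) (hw : 0 < w)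
    (hnull : ∀ d : ℝ, Q {x | η x = d} = 0)
    (hi : Integrable (fun x => (f x - t x) * (w * (1 - 2 * η x) - c)) Q)
    (hnn : ∀ x, 0 ≤ (f x - t x) * (w * (1 - 2 * η x) - c))
    (hz : ∫ x, (f x - t x) * (w * (1 - 2 * η x) - c) ∂Q = 0) : ∀ᵐ x ∂Q, f x = t x := by
  have h1 := (integral_eq_zero_iff_of_nonneg hnn hi).1 hz
  have h2 : ∀ᵐ x ∂Q, η x ≠ 1 / 2 - c / (2 * w) := by
    rw [ae_iff]; simpa using hnull _
  filter_upwards [h1, h2] with x h1 h2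
  have h1' : (f x - t x) * (w * (1 - 2 * η x) - c) = 0 := h1
  rcases mul_eq_zero.1 h1' with h | h
  · linarith
  · exfalso; apply h2; field_simp; linarith

theorem aux_g_congr (q : ℝ) (η : ℝ → ℝ) (hη : Measurable η) (P0 P1 : Measure ℝ) (l m : ℝ)
    (h0 : ∀ᵐ x ∂P0, fThresh q η l x 0 = fThresh q η m x 0)
    (h1 : ∀ᵐ x ∂P1, fThresh q η l x 1 = fThresh q η m x 1) :
    gFun q η P0 P1 l = gFun q η P0 P1 m := by
  rw [← aux_MD_s16 q η hη, ← aux_MD_s16 q η hη]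
  unfold MDF
  rw [integral_congr_ae h0, integral_congr_ae h1]

theorem aux_half (A B : Measure ℝ) [IsProbabilityMeasure A] [IsProbabilityMeasure B] (s : Set ℝ) :
    (((2:ENNReal)⁻¹ • (A + B)) s).toReal = ((A s).toReal + (B s).toReal) / 2 := by
  simp only [Measure.smul_apply, Measure.add_apply, smul_eq_mul, ENNReal.toReal_mul,
    ENNReal.toReal_inv, ENNReal.toReal_add (measure_ne_top A s) (measure_ne_top B s),
    ENNReal.toReal_ofNat]
  ring

theorem aux_ae_half (A B : Measure ℝ) (p : ℝ → Prop)
    (h : ∀ᵐ x ∂((2:ENNReal)⁻¹ • (A + B)), p x) : (∀ᵐ x ∂A, p x) ∧ ∀ᵐ x ∂B, p x := by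
  rw [Measure.ae_ennreal_smul_measure_iff (by simp)] at h
  exact ae_add_measure_iff.1 h

theorem aux_avg (a b c : ℝ) (ha : a = 0 ∨ a = 1) (hb : b = 0 ∨ b = 1) (hc : c = 0 ∨ c = 1)
    (h : (a + b) / 2 = c) : a = c ∧ b = c := by
  rcases ha with rfl | rfl <;> rcases hb with rfl | rfl <;> rcases hc with rfl | rfl <;>
    norm_num at h <;> simp

/-- an ensemble classifier meeting the global fairness level `ε`
has error at least that of the centralized fair classifier `f_ε^CFL`, with
equality iff both local thresholds coincide with the centralized one. -/
theorem ensemble_vs_cfl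
    (q : ℝ) (hq : q ∈ Ioo (0:ℝ) 1)
    (P0 P1 : Fin 2 → Measure ℝ)
    [∀ i, IsProbabilityMeasure (P0 i)] [∀ i, IsProbabilityMeasure (P1 i)]
    (hposint : ∀ i, ∀ x y : ℝ, x < y → 0 < (P0 i) (Ioo x y) ∧ 0 < (P1 i) (Ioo x y))
    (η : ℝ → ℝ) (hη_mono : StrictMono η) (hη_mem : ∀ x, η x ∈ Icc (0:ℝ) 1)
    (hnull : ∀ i, ∀ c : ℝ, (P0 i) {x | η x = c} = 0 ∧ (P1 i) {x | η x = c} = 0)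
    (g : Fin 2 → ℝ → ℝ) (hgdef : ∀ i, g i = gFun q η (P0 i) (P1 i))
    (ginv : Fin 2 → ℝ → ℝ)
    (hg : ∀ i, GoodG (max q (1 - q)) (g i) (ginv i))
    (gg : ℝ → ℝ) (hggdef : ∀ lam, gg lam = (g 0 lam + g 1 lam) / 2)
    (ginvg : ℝ → ℝ) (hgg : GoodG (max q (1 - q)) gg ginvg)
    (ε ε0 ε1 : ℝ) (hε : ε ∈ Icc (0:ℝ) 1) (hε0 : ε0 ∈ Icc (0:ℝ) 1) (hε1 : ε1 ∈ Icc (0:ℝ) 1)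
    (lam0 lam1 lamE : ℝ)
    (hlam0 : lam0 = ginv 0 (Real.sign (g 0 0) * min ε0 |g 0 0|))
    (hlam1 : lam1 = ginv 1 (Real.sign (g 1 0) * min ε1 |g 1 0|))
    (hlamE : lamE = ginvg (Real.sign (gg 0) * min ε |gg 0|))
    (fens : ℝ → Fin 2 → ℝ)
    (hfens : fens = fun x a => (fThresh q η lam0 x a + fThresh q η lam1 x a) / 2)
    (hfair : DPD ((2:ENNReal)⁻¹ • (P0 0 + P0 1)) ((2:ENNReal)⁻¹ • (P1 0 + P1 1)) fens ≤ ε) :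
    errF q η ((2:ENNReal)⁻¹ • (P0 0 + P0 1)) ((2:ENNReal)⁻¹ • (P1 0 + P1 1)) (fThresh q η lamE)
      ≤ errF q η ((2:ENNReal)⁻¹ • (P0 0 + P0 1)) ((2:ENNReal)⁻¹ • (P1 0 + P1 1)) fens ∧
    (errF q η ((2:ENNReal)⁻¹ • (P0 0 + P0 1)) ((2:ENNReal)⁻¹ • (P1 0 + P1 1)) fens
        = errF q η ((2:ENNReal)⁻¹ • (P0 0 + P0 1)) ((2:ENNReal)⁻¹ • (P1 0 + P1 1))
            (fThresh q η lamE)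
      ↔ (lam0 = lamE ∧ lam1 = lamE)) := by
  obtain ⟨hq0, hq1⟩ := hq
  have hq1' : 0 < 1 - q := by linarith
  have hM : 0 < max q (1 - q) := lt_max_of_lt_left hq0
  have hη : Measurable η := hη_mono.monotone.measurable
  have hgQ : ∀ l, gFun q η ((2:ENNReal)⁻¹ • (P0 0 + P0 1)) ((2:ENNReal)⁻¹ • (P1 0 + P1 1)) l
      = gg l := by
    intro l
    rw [hggdef, hgdef, hgdef]
    unfold gFun
    rw [aux_half, aux_half]
    ring
  have hN0 : ∀ d, ((2:ENNReal)⁻¹ • (P0 0 + P0 1)) {x | η x = d} = 0 := by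
    intro d; simp [(hnull 0 d).1, (hnull 1 d).1]
  have hN1 : ∀ d, ((2:ENNReal)⁻¹ • (P1 0 + P1 1)) {x | η x = d} = 0 := by
    intro d; simp [(hnull 0 d).2, (hnull 1 d).2]
  have hF0 : IsFiniteMeasure ((2:ENNReal)⁻¹ • (P0 0 + P0 1)) :=
    Measure.smul_finite _ (by simp)
  have hF1 : IsFiniteMeasure ((2:ENNReal)⁻¹ • (P1 0 + P1 1)) :=
    Measure.smul_finite _ (by simp)
  have hae0 := aux_ae_half (P0 0) (P0 1)
  have hae1 := aux_ae_half (P1 0) (P1 1)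
  generalize ((2:ENNReal)⁻¹ • (P0 0 + P0 1)) = Q0 at *
  generalize ((2:ENNReal)⁻¹ • (P1 0 + P1 1)) = Q1 at *
  have hfm : ∀ a x, fens x a ∈ Icc (0:ℝ) 1 := by
    intro a x
    rw [hfens]
    rcases aux_thresh_mem q η lam0 x a with h | h <;>
      rcases aux_thresh_mem q η lam1 x a with h' | h' <;> simp only [h, h'] <;> norm_num
  have htm : ∀ a x, fThresh q η lamE x a ∈ Icc (0:ℝ) 1 := by
    intro a x
    rcases aux_thresh_mem q η lamE x a with h | h <;> rw [h] <;> norm_num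
  have hf : ∀ a, Measurable fun x => fens x a := by
    intro a
    rw [hfens]
    exact ((aux_thresh_meas q η hη lam0 a).add (aux_thresh_meas q η hη lam1 a)).div_const 2
  have ht := aux_thresh_meas q η hη lamE
  obtain ⟨i0, d0⟩ := aux_group Q0 η (fun x => fens x 0) (fun x => fThresh q η lamE x 0) hη hη_mem
    (hf 0) (hfm 0) (ht 0) (htm 0) (1 - q) lamE
  obtain ⟨i1, d1⟩ := aux_group Q1 η (fun x => fens x 1) (fun x => fThresh q η lamE x 1) hη hη_mem
    (hf 1) (hfm 1) (ht 1) (htm 1) q (-lamE)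
  have n0 : ∀ x, 0 ≤ (fens x 0 - fThresh q η lamE x 0) * ((1 - q) * (1 - 2 * η x) - lamE) := by
    intro x
    obtain ⟨a, b⟩ := hfm 0 x
    have e : lamE / (2 * (1 - q)) * (2 * (1 - q)) = lamE := by field_simp
    have e2 : fThresh q η lamE x 0 = if η x > 1/2 - lamE / (2*(1-q)) then 1 else 0 := rfl
    rw [e2]
    split_ifs with h
    · apply mul_nonneg_of_nonpos_of_nonpos (by linarith)
      nlinarith
    · apply mul_nonneg (by linarith)
      nlinarith
  have n1 : ∀ x, 0 ≤ (fens x 1 - fThresh q η lamE x 1) * (q * (1 - 2 * η x) - -lamE) := by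
    intro x
    obtain ⟨a, b⟩ := hfm 1 x
    have e : lamE / (2 * q) * (2 * q) = lamE := by field_simp
    have e2 : fThresh q η lamE x 1 = if η x > 1/2 + lamE / (2*q) then 1 else 0 := rfl
    rw [e2]
    split_ifs with h
    · apply mul_nonneg_of_nonpos_of_nonpos (by linarith)
      nlinarith
    · apply mul_nonneg (by linarith)
      nlinarith
  have I0 : 0 ≤ ∫ x, (fens x 0 - fThresh q η lamE x 0) * ((1 - q) * (1 - 2 * η x) - lamE) ∂Q0 :=
    integral_nonneg fun x => n0 x
  have I1 : 0 ≤ ∫ x, (fens x 1 - fThresh q η lamE x 1) * (q * (1 - 2 * η x) - -lamE) ∂Q1 :=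
    integral_nonneg fun x => n1 x
  have hlamb := aux_lam _ hM gg ginvg hgg ε lamE _ hε hlamE hfair
  rw [← hgQ lamE, ← aux_MD_s16 q η hη] at hlamb
  have D : errF q η Q0 Q1 fens - errF q η Q0 Q1 (fThresh q η lamE) =
      lamE * (MDF Q0 Q1 fens - MDF Q0 Q1 (fThresh q η lamE))
      + (∫ x, (fens x 0 - fThresh q η lamE x 0) * ((1 - q) * (1 - 2 * η x) - lamE) ∂Q0)
      + ∫ x, (fens x 1 - fThresh q η lamE x 1) * (q * (1 - 2 * η x) - -lamE) ∂Q1 := by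
    unfold errF MDF
    linear_combination d0 + d1
  refine ⟨by linarith, ?_, ?_⟩
  · intro heq
    have a0 := aux_ae Q0 η _ _ (1 - q) lamE hq1' hN0 i0 n0 (by linarith)
    have a1 := aux_ae Q1 η _ _ q (-lamE) hq0 hN1 i1 n1 (by linarith)
    have b : ∀ (a : Fin 2) x, fens x a = fThresh q η lamE x a →
        fThresh q η lam0 x a = fThresh q η lamE x a ∧
        fThresh q η lam1 x a = fThresh q η lamE x a := by
      intro a x h
      rw [hfens] at h
      exact aux_avg _ _ _ (aux_thresh_mem ..) (aux_thresh_mem ..) (aux_thresh_mem ..) h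
    have c0 := hae0 _ a0
    have c1 := hae1 _ a1
    have m0 := ((hg 0).2.2.2.2 _ (aux_sign ε0 (g 0 0) hε0)).1
    have m1 := ((hg 1).2.2.2.2 _ (aux_sign ε1 (g 1 0) hε1)).1
    have mE := (hgg.2.2.2.2 _ (aux_sign ε (gg 0) hε)).1
    rw [← hlam0] at m0
    rw [← hlam1] at m1
    rw [← hlamE] at mE
    constructor
    · apply (hg 0).2.1.injOn m0 mE
      rw [hgdef]
      exact aux_g_congr q η hη _ _ _ _ (c0.1.mono fun x h => (b 0 x h).1)
        (c1.1.mono fun x h => (b 1 x h).1)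
    · apply (hg 1).2.1.injOn m1 mE
      rw [hgdef]
      exact aux_g_congr q η hη _ _ _ _ (c0.2.mono fun x h => (b 0 x h).2)
        (c1.2.mono fun x h => (b 1 x h).2)
  · rintro ⟨h0, h1⟩
    have : fens = fThresh q η lamE := by
      rw [hfens, h0, h1]
      funext x a
      ring
    rw [this]

end
end

section
/- Assume g₀(0)·g₁(0) < 0. Then for every ε ∈ [0,1] with ε < |g(0)| and for all ε₀, ε₁ ∈ [0,1] such that DPDisp(f_{ε₀,ε₁}^ens) ≤ ε, one has the strict inequality err(f_{ε₀,ε₁}^ens) > err(f_ε^CFL). That is, when the unconstrained optimal classifier favors different groups on the two clients, the LFT+Ensemble approach is strictly worse than centralized fair learning at every fairness level below the unconstrained disparity. -/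
open MeasureTheory Set

noncomputable section

/-- Threshold indicator. -/
def thr (η : ℝ → ℝ) (t : ℝ) (x : ℝ) : ℝ := if η x > t then 1 else 0

/-- Error integrand of a scalar classifier value. -/
def erI (η : ℝ → ℝ) (f : ℝ → ℝ) (x : ℝ) : ℝ := f x * (1 - η x) + (1 - f x) * η x

lemma thr_meas {η : ℝ → ℝ} (hm : StrictMono η) (t : ℝ) : Measurable (thr η t) := by
  have h := hm.monotone.measurable
  exact Measurable.ite (measurableSet_lt measurable_const h) measurable_const measurable_const

lemma thr_int {η : ℝ → ℝ} (hm : StrictMono η) (t : ℝ) (Q : Measure ℝ) [IsFiniteMeasure Q] :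
    Integrable (thr η t) Q := by
  refine Integrable.of_bound (thr_meas hm t).aestronglyMeasurable 1 (Filter.Eventually.of_forall ?_)
  intro x
  unfold thr
  split_ifs <;> simp

lemma erI_int {η : ℝ → ℝ} (hm : StrictMono η) (hmem : ∀ x, η x ∈ Icc (0:ℝ) 1) (t : ℝ)
    (Q : Measure ℝ) [IsFiniteMeasure Q] : Integrable (erI η (thr η t)) Q := by
  have h := hm.monotone.measurable
  have h2 := thr_meas hm t
  refine Integrable.of_bound (C := 1) ?_ (Filter.Eventually.of_forall ?_)
  · apply Measurable.aestronglyMeasurable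
    unfold erI
    fun_prop
  · intro x
    have := hmem x
    unfold erI thr
    rw [Real.norm_eq_abs, abs_le]
    split_ifs <;> constructor <;> linarith [this.1, this.2]

lemma thr_integral {η : ℝ → ℝ} (hm : StrictMono η) (t : ℝ) (Q : Measure ℝ) :
    ∫ x, thr η t x ∂Q = (Q {x | η x > t}).toReal := by
  have hs : MeasurableSet {x | η x > t} := measurableSet_lt measurable_const hm.monotone.measurable
  have : thr η t = ({x | η x > t}).indicator (fun _ => (1:ℝ)) := by
    funext x
    simp [thr, Set.indicator]
  rw [this, integral_indicator hs]
  simp [Measure.real]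

lemma thr_opt {η : ℝ → ℝ} (hm : StrictMono η) (hmem : ∀ x, η x ∈ Icc (0:ℝ) 1) (t s : ℝ)
    (Q : Measure ℝ) [IsFiniteMeasure Q] :
    (1 - 2 * t) * ((∫ x, thr η s x ∂Q) - ∫ x, thr η t x ∂Q)
      ≤ (∫ x, erI η (thr η s) x ∂Q) - ∫ x, erI η (thr η t) x ∂Q := by
  rw [← integral_sub (thr_int hm s Q) (thr_int hm t Q), ← integral_const_mul,
    ← integral_sub (erI_int hm hmem s Q) (erI_int hm hmem t Q)]
  apply integral_mono
  · exact ((thr_int hm s Q).sub (thr_int hm t Q)).const_mul _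
  · exact (erI_int hm hmem s Q).sub (erI_int hm hmem t Q)
  · intro x
    simp only [erI, thr]
    split_ifs <;> linarith

lemma errF_thresh (q : ℝ) (η : ℝ → ℝ) (Q0 Q1 : Measure ℝ) (l : ℝ) :
    errF q η Q0 Q1 (fThresh q η l) =
      (1 - q) * (∫ x, erI η (thr η (1/2 - l / (2*(1-q)))) x ∂Q0)
        + q * ∫ x, erI η (thr η (1/2 + l / (2*q))) x ∂Q1 := by
  simp [errF, fThresh, erI, thr]

lemma MDF_thresh {q : ℝ} {η : ℝ → ℝ} (hm : StrictMono η) (Q0 Q1 : Measure ℝ) (l : ℝ) :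
    MDF Q0 Q1 (fThresh q η l) = gFun q η Q0 Q1 l := by
  rw [gFun, ← thr_integral hm, ← thr_integral hm]
  simp [MDF, fThresh, thr]

lemma thresh_opt {q : ℝ} (hq : q ∈ Ioo (0:ℝ) 1) {η : ℝ → ℝ} (hm : StrictMono η)
    (hmem : ∀ x, η x ∈ Icc (0:ℝ) 1) (Q0 Q1 : Measure ℝ) [IsFiniteMeasure Q0]
    [IsFiniteMeasure Q1] (l m : ℝ) :
    l * (gFun q η Q0 Q1 m - gFun q η Q0 Q1 l) ≤
      errF q η Q0 Q1 (fThresh q η m) - errF q η Q0 Q1 (fThresh q η l) := by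
  rw [errF_thresh, errF_thresh, gFun, gFun, ← thr_integral hm, ← thr_integral hm,
    ← thr_integral hm, ← thr_integral hm]
  have h0 : 0 < 1 - q := by linarith [hq.2]
  have h1 : 0 < q := hq.1
  have a := mul_le_mul_of_nonneg_left
    (thr_opt hm hmem (1/2 - l / (2*(1-q))) (1/2 - m / (2*(1-q))) Q0) h0.le
  have b := mul_le_mul_of_nonneg_left
    (thr_opt hm hmem (1/2 + l / (2*q)) (1/2 + m / (2*q)) Q1) h1.le
  have e0 : (1 - q) * (1 - 2 * (1/2 - l / (2*(1-q)))) = l := by field_simp; ring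
  have e1 : q * (1 - 2 * (1/2 + l / (2*q))) = -l := by field_simp; ring
  rw [← mul_assoc, e0] at a
  rw [← mul_assoc, e1] at b
  linarith

lemma MDF_avg {q : ℝ} {η : ℝ → ℝ} (hm : StrictMono η) (Q0 Q1 : Measure ℝ) [IsFiniteMeasure Q0]
    [IsFiniteMeasure Q1] (l m : ℝ) :
    MDF Q0 Q1 (fun x a => (fThresh q η l x a + fThresh q η m x a) / 2)
      = (gFun q η Q0 Q1 l + gFun q η Q0 Q1 m) / 2 := by
  have key : ∀ (Q : Measure ℝ) [IsFiniteMeasure Q] (s t : ℝ),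
      ∫ x, (thr η s x + thr η t x) / 2 ∂Q
        = ((∫ x, thr η s x ∂Q) + ∫ x, thr η t x ∂Q) / 2 := by
    intro Q _ s t
    rw [integral_div, integral_add (thr_int hm s Q) (thr_int hm t Q)]
  rw [gFun, gFun, ← thr_integral hm, ← thr_integral hm, ← thr_integral hm, ← thr_integral hm]
  have a := key Q0 (1/2 - l / (2*(1-q))) (1/2 - m / (2*(1-q)))
  have b := key Q1 (1/2 + l / (2*q)) (1/2 + m / (2*q))
  have : MDF Q0 Q1 (fun x a => (fThresh q η l x a + fThresh q η m x a) / 2)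
    = (∫ x, (thr η (1/2 - l / (2*(1-q))) x + thr η (1/2 - m / (2*(1-q))) x) / 2 ∂Q0)
      - ∫ x, (thr η (1/2 + l / (2*q)) x + thr η (1/2 + m / (2*q)) x) / 2 ∂Q1 := rfl
  rw [this, a, b]
  ring

lemma errF_avg {q : ℝ} {η : ℝ → ℝ} (hm : StrictMono η)
    (hmem : ∀ x, η x ∈ Icc (0:ℝ) 1) (Q0 Q1 : Measure ℝ) [IsFiniteMeasure Q0]
    [IsFiniteMeasure Q1] (l m : ℝ) :
    errF q η Q0 Q1 (fun x a => (fThresh q η l x a + fThresh q η m x a) / 2)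
      = (errF q η Q0 Q1 (fThresh q η l) + errF q η Q0 Q1 (fThresh q η m)) / 2 := by
  have key : ∀ (Q : Measure ℝ) [IsFiniteMeasure Q] (s t : ℝ),
      ∫ x, erI η (fun y => (thr η s y + thr η t y) / 2) x ∂Q
        = ((∫ x, erI η (thr η s) x ∂Q) + ∫ x, erI η (thr η t) x ∂Q) / 2 := by
    intro Q _ s t
    rw [← integral_add (erI_int hm hmem s Q) (erI_int hm hmem t Q), ← integral_div]
    congr 1
    funext x
    simp only [erI]
    ring
  rw [errF_thresh, errF_thresh]
  have a := key Q0 (1/2 - l / (2*(1-q))) (1/2 - m / (2*(1-q)))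
  have b := key Q1 (1/2 + l / (2*q)) (1/2 + m / (2*q))
  have : errF q η Q0 Q1 (fun x a => (fThresh q η l x a + fThresh q η m x a) / 2)
    = (1 - q) * (∫ x, erI η (fun y => (thr η (1/2 - l / (2*(1-q))) y
          + thr η (1/2 - m / (2*(1-q))) y) / 2) x ∂Q0)
      + q * ∫ x, erI η (fun y => (thr η (1/2 + l / (2*q)) y
          + thr η (1/2 + m / (2*q)) y) / 2) x ∂Q1 := rfl
  rw [this, a, b]
  ring

lemma gFun_mix (q : ℝ) (η : ℝ → ℝ) (A B C D : Measure ℝ) [IsFiniteMeasure A]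
    [IsFiniteMeasure B] [IsFiniteMeasure C] [IsFiniteMeasure D] (l : ℝ) :
    gFun q η ((2:ENNReal)⁻¹ • (A + B)) ((2:ENNReal)⁻¹ • (C + D)) l
      = (gFun q η A C l + gFun q η B D l) / 2 := by
  simp only [gFun, Measure.smul_apply, Measure.add_apply, smul_eq_mul, ENNReal.toReal_mul,
    ENNReal.toReal_inv, ENNReal.toReal_ofNat]
  rw [ENNReal.toReal_add (measure_ne_top _ _) (measure_ne_top _ _),
    ENNReal.toReal_add (measure_ne_top _ _) (measure_ne_top _ _)]
  ring

/-- The local multiplier satisfies its sign property and stays in the interval. -/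
lemma good_sign {M : ℝ} (hM : 0 < M) {g ginv : ℝ → ℝ} (h : GoodG M g ginv) {e : ℝ}
    (he : 0 ≤ e) :
    ginv (Real.sign (g 0) * min e |g 0|) ∈ Icc (-M) M ∧
    g (ginv (Real.sign (g 0) * min e |g 0|)) = Real.sign (g 0) * min e |g 0| ∧
    (0 < g 0 → ginv (Real.sign (g 0) * min e |g 0|) ≤ 0) ∧
    (g 0 < 0 → 0 ≤ ginv (Real.sign (g 0) * min e |g 0|)) := by
  obtain ⟨-, hs, him, -, hr⟩ := h
  have z : (0:ℝ) ∈ Icc (-M) M := ⟨by linarith, hM.le⟩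
  have hz : g 0 ∈ Icc (-1:ℝ) 1 := him ▸ mem_image_of_mem g z
  have hle : min e |g 0| ≤ |g 0| := min_le_right _ _
  have hge : 0 ≤ min e |g 0| := le_min he (abs_nonneg _)
  have habs : |g 0| ≤ 1 := abs_le.2 hz
  have hy : Real.sign (g 0) * min e |g 0| ∈ Icc (-1:ℝ) 1 := by
    rcases Real.sign_apply_eq (g 0) with h | h | h <;> rw [h] <;> constructor <;> linarith
  obtain ⟨h1, h2⟩ := hr _ hy
  refine ⟨h1, h2, ?_, ?_⟩
  · intro hp
    apply (hs.le_iff_le h1 z).1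
    rw [h2, Real.sign_of_pos hp]
    rw [abs_of_pos hp] at hle ⊢
    linarith
  · intro hp
    apply (hs.le_iff_le z h1).1
    rw [h2, Real.sign_of_neg hp]
    rw [abs_of_neg hp] at hle ⊢
    linarith

/-- Weak optimality at every multiplier plus strict monotonicity gives strict optimality. -/
lemma strict_opt {M : ℝ} {g E : ℝ → ℝ} (hs : StrictMonoOn g (Icc (-M) M))
    (hE : ∀ l m, l * (g m - g l) ≤ E m - E l) {l m : ℝ} (hl : l ∈ Icc (-M) M)
    (hm : m ∈ Icc (-M) M) (hne : l ≠ m) : l * (g m - g l) < E m - E l := by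
  have hk : (l + m) / 2 ∈ Icc (-M) M := ⟨by linarith [hl.1, hm.1], by linarith [hl.2, hm.2]⟩
  have a := hE l ((l + m) / 2)
  have b := hE ((l + m) / 2) m
  rcases lt_or_gt_of_ne hne with h | h
  · have c := hs hk hm (by linarith : (l + m) / 2 < m)
    nlinarith
  · have c := hs hm hk (by linarith : m < (l + m) / 2)
    nlinarith

/-- if the ERM favors different groups on the two clients
(`g₀(0)·g₁(0) < 0`), then for every fairness level `ε < |g(0)|`, any ensemble
classifier meeting the global constraint is strictly worse than `f_ε^CFL`. -/
theorem ensemble_strictly_worse_when_opposite_bias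
    (q : ℝ) (hq : q ∈ Ioo (0:ℝ) 1)
    (P0 P1 : Fin 2 → Measure ℝ)
    [∀ i, IsProbabilityMeasure (P0 i)] [∀ i, IsProbabilityMeasure (P1 i)]
    (hposint : ∀ i, ∀ x y : ℝ, x < y → 0 < (P0 i) (Ioo x y) ∧ 0 < (P1 i) (Ioo x y))
    (η : ℝ → ℝ) (hη_mono : StrictMono η) (hη_mem : ∀ x, η x ∈ Icc (0:ℝ) 1)
    (hnull : ∀ i, ∀ c : ℝ, (P0 i) {x | η x = c} = 0 ∧ (P1 i) {x | η x = c} = 0)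
    (g : Fin 2 → ℝ → ℝ) (hgdef : ∀ i, g i = gFun q η (P0 i) (P1 i))
    (ginv : Fin 2 → ℝ → ℝ)
    (hg : ∀ i, GoodG (max q (1 - q)) (g i) (ginv i))
    (gg : ℝ → ℝ) (hggdef : ∀ lam, gg lam = (g 0 lam + g 1 lam) / 2)
    (ginvg : ℝ → ℝ) (hgg : GoodG (max q (1 - q)) gg ginvg)
    (hopp : g 0 0 * g 1 0 < 0)
    (fens : ℝ → ℝ → (ℝ → Fin 2 → ℝ))
    (hfens : ∀ e0 e1, fens e0 e1 = fun x a =>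
      (fThresh q η (ginv 0 (Real.sign (g 0 0) * min e0 |g 0 0|)) x a
        + fThresh q η (ginv 1 (Real.sign (g 1 0) * min e1 |g 1 0|)) x a) / 2)
    (fcfl : ℝ → (ℝ → Fin 2 → ℝ))
    (hfcfl : ∀ e, fcfl e = fThresh q η (ginvg (Real.sign (gg 0) * min e |gg 0|))) :
    ∀ ε ∈ Icc (0:ℝ) 1, ε < |gg 0| →
      ∀ e0 ∈ Icc (0:ℝ) 1, ∀ e1 ∈ Icc (0:ℝ) 1,
        DPD ((2:ENNReal)⁻¹ • (P0 0 + P0 1)) ((2:ENNReal)⁻¹ • (P1 0 + P1 1)) (fens e0 e1) ≤ ε →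
        errF q η ((2:ENNReal)⁻¹ • (P0 0 + P0 1)) ((2:ENNReal)⁻¹ • (P1 0 + P1 1)) (fcfl ε)
          < errF q η ((2:ENNReal)⁻¹ • (P0 0 + P0 1)) ((2:ENNReal)⁻¹ • (P1 0 + P1 1))
              (fens e0 e1) := by
  intro ε hε hlt e0 he0 e1 he1 hD
  have hM : 0 < max q (1 - q) := lt_max_of_lt_left hq.1
  obtain ⟨m0, -, p0, n0⟩ := good_sign hM (hg 0) he0.1
  obtain ⟨m1, -, p1, n1⟩ := good_sign hM (hg 1) he1.1
  obtain ⟨m2, v2, -, -⟩ := good_sign hM hgg hε.1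
  rw [hfens] at hD ⊢
  rw [hfcfl]
  generalize ginv 0 (Real.sign (g 0 0) * min e0 |g 0 0|) = l0 at *
  generalize ginv 1 (Real.sign (g 1 0) * min e1 |g 1 0|) = l1 at *
  generalize ginvg (Real.sign (gg 0) * min ε |gg 0|) = l2 at *
  rw [min_eq_left hlt.le] at v2
  set Q0 := (2:ENNReal)⁻¹ • (P0 0 + P0 1) with hQ0
  set Q1 := (2:ENNReal)⁻¹ • (P1 0 + P1 1) with hQ1
  haveI : IsFiniteMeasure Q0 := Measure.smul_finite _ (by simp)
  haveI : IsFiniteMeasure Q1 := Measure.smul_finite _ (by simp)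
  have hmix : ∀ l, gFun q η Q0 Q1 l = gg l := by
    intro l
    rw [hQ0, hQ1, gFun_mix, hggdef, hgdef, hgdef]
  rw [DPD, MDF_avg hη_mono, hmix, hmix, abs_le] at hD
  rw [errF_avg hη_mono hη_mem]
  have hs := hgg.2.1
  have hE : ∀ l m, l * (gg m - gg l) ≤ (fun l => errF q η Q0 Q1 (fThresh q η l)) m
      - (fun l => errF q η Q0 Q1 (fThresh q η l)) l := by
    intro l m
    rw [← hmix, ← hmix]
    exact thresh_opt hq hη_mono hη_mem Q0 Q1 l m
  have z : (0:ℝ) ∈ Icc (-(max q (1 - q))) (max q (1 - q)) := ⟨by linarith, hM.le⟩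
  have hl2 : l2 ≠ 0 ∧ 0 ≤ l2 * ((gg l0 + gg l1) / 2 - gg l2) := by
    rcases lt_trichotomy (gg 0) 0 with h | h | h
    · rw [Real.sign_of_neg h] at v2
      rw [abs_of_neg h] at hlt
      have : 0 < l2 := (hs.lt_iff_lt z m2).1 (by linarith)
      exact ⟨this.ne', mul_nonneg this.le (by linarith [hD.1])⟩
    · rw [h, abs_zero] at hlt
      linarith [hε.1]
    · rw [Real.sign_of_pos h] at v2
      rw [abs_of_pos h] at hlt
      have : l2 < 0 := (hs.lt_iff_lt m2 z).1 (by linarith)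
      exact ⟨this.ne, mul_nonneg_of_nonpos_of_nonpos this.le (by linarith [hD.2])⟩
  have hor : l2 ≠ l0 ∨ l2 ≠ l1 := by
    by_contra hc
    push Not at hc
    obtain ⟨c0, c1⟩ := hc
    apply hl2.1
    rcases mul_neg_iff.1 hopp with ⟨a, b⟩ | ⟨a, b⟩
    · have := p0 a
      have := n1 b
      linarith
    · have := n0 a
      have := p1 b
      linarith
  have w0 := hE l2 l0
  have w1 := hE l2 l1
  have key := hl2.2
  rcases hor with h | h
  · have := strict_opt hs hE m2 m0 h
    simp only at *
    nlinarith
  · have := strict_opt hs hE m2 m1 h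
    simp only at *
    nlinarith


end
end
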